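/- Let n ≥ 2, let q ≥ 7 be a prime power with q ∉ {8,9,16,25,27,49}, and let c be a code word of C_{n-1}(n,q) with wt(c) ≤ B_{n,q}. If there exists a (q−1)-secant to supp(c), then there also exists a 3-secant to supp(c). -/

import Mathlib

open scoped Classical

noncomputable section

namespace PGCode

open Projectivization

/-- The points of `PG(n, q)`, where the field `F` has order `q`. -/
abbrev Pt (F : Type) [Field F] (n : ℕ) := Projectivization F (Fin (n + 1) → F)

variable {F : Type} [Field F]

/-- A point of `PG(n,q)` lies in the projective subspace determined by a linear subspace `W`. -/
def ptIn {n : ℕ} (P : Pt F n) (W : Submodule F (Fin (n + 1) → F)) : Prop :=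
  Projectivization.submodule P ≤ W

/-- The set of points of the projective subspace determined by a linear subspace `W`. -/
def ptsIn {n : ℕ} (W : Submodule F (Fin (n + 1) → F)) : Set (Pt F n) :=
  {P | ptIn P W}

/-- The incidence vector (over `F_p = ZMod p`) of the projective subspace determined by `W`. -/
def incVec (p : ℕ) {n : ℕ} (W : Submodule F (Fin (n + 1) → F)) : Pt F n → ZMod p :=
  fun P => if ptIn P W then (1 : ZMod p) else 0

/-- The code `C_{n-1}(n,q)`: the `F_p`-span of the incidence vectors of all hyperplanes
(projective dimension `n-1`, i.e. linear dimension `n`). -/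
def code (F : Type) [Field F] (p n : ℕ) : Submodule (ZMod p) (Pt F n → ZMod p) :=
  Submodule.span (ZMod p)
    {v | ∃ W : Submodule F (Fin (n + 1) → F), Module.finrank F W = n ∧ v = incVec p W}

/-- The support of a word. -/
def supp {p n : ℕ} (v : Pt F n → ZMod p) : Set (Pt F n) := {P | v P ≠ 0}

/-- The weight of a word. -/
def wt {p n : ℕ} (v : Pt F n → ZMod p) : ℕ := (supp v).ncard

/-- The weight of the restriction of a word to the subspace determined by `W`. -/
def wtRes {p n : ℕ} (c : Pt F n → ZMod p) (W : Submodule F (Fin (n + 1) → F)) : ℕ :=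
  (ptsIn W ∩ supp c).ncard

/-- `θ_m = (q^(m+1) - 1)/(q - 1)`, with `θ_m = 0` for `m < 0`. -/
def theta (q : ℕ) (m : ℤ) : ℕ :=
  if m < 0 then 0 else ∑ i ∈ Finset.range (m.toNat + 1), q ^ i

/-- The bound `B_{n,q}` from the paper. -/
def B (n q : ℕ) : ℝ :=
  if q < 7 ∨ q = 8 ∨ q = 9 ∨ q = 16 ∨ q = 25 ∨ q = 27 ∨ q = 49 then
    2 * (q : ℝ) ^ (n - 1)
  else if q = 7 ∨ q = 11 ∨ q = 13 ∨ q = 17 then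
    (3 * q - Real.sqrt (6 * q) - 1 / 2) * (q : ℝ) ^ (n - 2)
  else if q = 19 ∨ q = 121 then
    (3 * q - Real.sqrt (6 * q) + 9 / 2) * (q : ℝ) ^ (n - 2)
  else if q = 29 ∨ q = 31 ∨ q = 32 then
    (4 * q - 4 * Real.sqrt q - 25 / 2) * (q : ℝ) ^ (n - 2)
  else
    (4 * q - Real.sqrt (8 * q) - 33 / 2) * (q : ℝ) ^ (n - 2)

/-- A line of `PG(n,q)`: a linear subspace of dimension `2`. -/
def IsLine {n : ℕ} (l : Submodule F (Fin (n + 1) → F)) : Prop := Module.finrank F l = 2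

/-- A plane of `PG(n,q)`: a linear subspace of dimension `3`. -/
def IsPlane {n : ℕ} (W : Submodule F (Fin (n + 1) → F)) : Prop := Module.finrank F W = 3

/-- The line `l` is an `α`-secant to `supp c`. -/
def secant {p n : ℕ} (c : Pt F n → ZMod p) (l : Submodule F (Fin (n + 1) → F)) (α : ℕ) : Prop :=
  IsLine l ∧ (ptsIn l ∩ supp c).ncard = α

/-- The restriction of `c` to the plane `W` is a linear combination of at most two lines of `W`. -/
def TwoLineComb (p : ℕ) {n : ℕ} (c : Pt F n → ZMod p) (W : Submodule F (Fin (n + 1) → F)) :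
    Prop :=
  ∃ l₁ l₂ : Submodule F (Fin (n + 1) → F), IsLine l₁ ∧ IsLine l₂ ∧ l₁ ≤ W ∧ l₂ ≤ W ∧
    ∃ a b : ZMod p, ∀ P : Pt F n, ptIn P W → c P = a * incVec p l₁ P + b * incVec p l₂ P

/-- Type `T^△`: the restriction of `c` to the plane `W` is a linear combination (with nonzero
coefficients) of three nonconcurrent lines of `W`. -/
def TypeTri (p : ℕ) {n : ℕ} (c : Pt F n → ZMod p) (W : Submodule F (Fin (n + 1) → F)) : Prop :=
  ∃ l₁ l₂ l₃ : Submodule F (Fin (n + 1) → F),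
    IsLine l₁ ∧ IsLine l₂ ∧ IsLine l₃ ∧ l₁ ≤ W ∧ l₂ ≤ W ∧ l₃ ≤ W ∧
    l₁ ≠ l₂ ∧ l₁ ≠ l₃ ∧ l₂ ≠ l₃ ∧
    (¬ ∃ P : Pt F n, ptIn P l₁ ∧ ptIn P l₂ ∧ ptIn P l₃) ∧
    ∃ a₁ a₂ a₃ : ZMod p, a₁ ≠ 0 ∧ a₂ ≠ 0 ∧ a₃ ≠ 0 ∧
      ∀ P : Pt F n, ptIn P W →
        c P = a₁ * incVec p l₁ P + a₂ * incVec p l₂ P + a₃ * incVec p l₃ P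

/-- Type `T^★`: the restriction of `c` to the plane `W` is a linear combination (with nonzero
coefficients) of three distinct concurrent lines of `W`. -/
def TypeStar (p : ℕ) {n : ℕ} (c : Pt F n → ZMod p) (W : Submodule F (Fin (n + 1) → F)) : Prop :=
  ∃ l₁ l₂ l₃ : Submodule F (Fin (n + 1) → F),
    IsLine l₁ ∧ IsLine l₂ ∧ IsLine l₃ ∧ l₁ ≤ W ∧ l₂ ≤ W ∧ l₃ ≤ W ∧
    l₁ ≠ l₂ ∧ l₁ ≠ l₃ ∧ l₂ ≠ l₃ ∧
    (∃ P : Pt F n, ptIn P l₁ ∧ ptIn P l₂ ∧ ptIn P l₃) ∧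
    ∃ a₁ a₂ a₃ : ZMod p, a₁ ≠ 0 ∧ a₂ ≠ 0 ∧ a₃ ≠ 0 ∧
      ∀ P : Pt F n, ptIn P W →
        c P = a₁ * incVec p l₁ P + a₂ * incVec p l₂ P + a₃ * incVec p l₃ P

/-- The base code word `c₀` of the `T^odd` construction on `PG(2,p)`:
`c₀(0,1,a) = a`, `c₀(1,0,b) = b`, `c₀(1,1,c) = -c`, and `c₀ = 0` elsewhere. -/
def oddBase (p : ℕ) [Fact p.Prime] : Pt (ZMod p) 2 → ZMod p := fun P =>
  if P.rep 0 = 0 ∧ P.rep 1 ≠ 0 then P.rep 2 / P.rep 1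
  else if P.rep 1 = 0 ∧ P.rep 0 ≠ 0 then P.rep 2 / P.rep 0
  else if P.rep 0 = P.rep 1 ∧ P.rep 0 ≠ 0 then -(P.rep 2 / P.rep 0)
  else 0

/-- The line `m : X₀ = 0` of `PG(2,p)`. -/
def lineM1 (p : ℕ) [Fact p.Prime] : Submodule (ZMod p) (Fin 3 → ZMod p) :=
  LinearMap.ker (LinearMap.proj 0 : (Fin 3 → ZMod p) →ₗ[ZMod p] ZMod p)

/-- The line `m' : X₁ = 0` of `PG(2,p)`. -/
def lineM2 (p : ℕ) [Fact p.Prime] : Submodule (ZMod p) (Fin 3 → ZMod p) :=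
  LinearMap.ker (LinearMap.proj 1 : (Fin 3 → ZMod p) →ₗ[ZMod p] ZMod p)

/-- The line `m'' : X₀ = X₁` of `PG(2,p)`. -/
def lineM3 (p : ℕ) [Fact p.Prime] : Submodule (ZMod p) (Fin 3 → ZMod p) :=
  LinearMap.ker ((LinearMap.proj 0 : (Fin 3 → ZMod p) →ₗ[ZMod p] ZMod p) - LinearMap.proj 1)

/-- The code word `d = (γ c₀ + λ m + λ' m' + λ'' m'')^π` of the `T^odd` construction, where the
collineation `π` of `PG(2,p)` is the inverse of the homography induced by the linear
equivalence `g`. -/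
def oddWord (p : ℕ) [Fact p.Prime] (g : (Fin 3 → ZMod p) ≃ₗ[ZMod p] (Fin 3 → ZMod p))
    (γ lam lam' lam'' : ZMod p) : Pt (ZMod p) 2 → ZMod p := fun P =>
  γ * oddBase p (Projectivization.map g.toLinearMap g.injective P) +
    lam * incVec p (lineM1 p) (Projectivization.map g.toLinearMap g.injective P) +
    lam' * incVec p (lineM2 p) (Projectivization.map g.toLinearMap g.injective P) +
    lam'' * incVec p (lineM3 p) (Projectivization.map g.toLinearMap g.injective P)

/-- The semilinear embedding of `PG(2,p)` onto the plane of `PG(n,q)` spanned by the linearly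
independent vectors `b 0, b 1, b 2`, relative to the field embedding `σ : F_p → F`. -/
def planeEmbed {n : ℕ} {p : ℕ} [Fact p.Prime] (σ : ZMod p →+* F)
    (b : Fin 3 → (Fin (n + 1) → F)) (hb : LinearIndependent F b) :
    Pt (ZMod p) 2 → Pt F n := fun P =>
  Projectivization.mk F (∑ i, σ (P.rep i) • b i) (by
    intro hzero
    have h0 : ∀ i ∈ Finset.univ, σ (P.rep i) = 0 :=
      linearIndependent_iff'.mp hb Finset.univ (fun i => σ (P.rep i)) hzero
    have h1 : P.rep = 0 := funext fun i => σ.injective (by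
      simp only [Pi.zero_apply, map_zero]; exact h0 i (Finset.mem_univ i))
    exact P.rep_nonzero h1)

/-- Type `T^odd`: this requires `q = p` to be prime (`|F| = p`), and `c` restricted to the plane
`W` (spanned by the frame `b`) must coincide, via a semilinear identification of `W` with
`PG(2,p)`, with a code word `d` of the `T^odd` construction. -/
def TypeOdd (p : ℕ) [Fact p.Prime] [Fintype F] {n : ℕ} (c : Pt F n → ZMod p)
    (W : Submodule F (Fin (n + 1) → F)) : Prop :=
  Fintype.card F = p ∧
  ∃ (σ : ZMod p →+* F) (b : Fin 3 → (Fin (n + 1) → F)) (hb : LinearIndependent F b),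
    Submodule.span F (Set.range b) = W ∧
    ∃ (g : (Fin 3 → ZMod p) ≃ₗ[ZMod p] (Fin 3 → ZMod p)) (γ lam lam' lam'' : ZMod p), γ ≠ 0 ∧
      ∀ Q : Pt (ZMod p) 2, c (planeEmbed σ b hb Q) = oddWord p g γ lam lam' lam'' Q

/-- The list of plane types `T_0, T_{q+1}, T_{2q}, T_{2q+1}, T^odd, T^△, T^★`. -/
inductive PlaneT : Type where
  | T0 | Tq1 | T2q | T2q1 | Todd | Ttri | Tstar
deriving DecidableEq

/-- The restriction of `c` to the plane `W` is a code word of the given type. -/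
def PlaneIsType (p q : ℕ) [Fact p.Prime] [Fintype F] {n : ℕ} (c : Pt F n → ZMod p)
    (W : Submodule F (Fin (n + 1) → F)) : PlaneT → Prop
  | .T0 => TwoLineComb p c W ∧ wtRes c W = 0
  | .Tq1 => TwoLineComb p c W ∧ wtRes c W = q + 1
  | .T2q => TwoLineComb p c W ∧ wtRes c W = 2 * q
  | .T2q1 => TwoLineComb p c W ∧ wtRes c W = 2 * q + 1
  | .Todd => TypeOdd p c W
  | .Ttri => TypeTri p c W
  | .Tstar => TypeStar p c W

/-- The plane `W` is of type `𝒯`. -/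
def TypeT (p q : ℕ) [Fact p.Prime] [Fintype F] {n : ℕ} (c : Pt F n → ZMod p)
    (W : Submodule F (Fin (n + 1) → F)) : Prop :=
  IsPlane W ∧ ∃ t : PlaneT, PlaneIsType p q c W t

/-- The plane `W` is of type `𝒪`. -/
def TypeO (p q : ℕ) [Fact p.Prime] [Fintype F] {n : ℕ} (c : Pt F n → ZMod p)
    (W : Submodule F (Fin (n + 1) → F)) : Prop :=
  IsPlane W ∧ ¬ TypeT p q c W

/-- The restriction of `c` to the `k`-space `Sp` (linear dimension `k+1`) is of type `t`:
there is a `(k-3)`-space `κ ⊆ Sp` on which `c` is a scalar multiple of the all-one function,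
a plane `π ⊆ Sp` of type `t` disjoint from `κ`, and `c P = c (⟨κ, P⟩ ∩ π)` for every point
`P` of `Sp` outside `κ`. -/
def SpaceIsType (p q : ℕ) [Fact p.Prime] [Fintype F] {n : ℕ} (c : Pt F n → ZMod p)
    (Sp : Submodule F (Fin (n + 1) → F)) (k : ℕ) (t : PlaneT) : Prop :=
  Module.finrank F Sp = k + 1 ∧
  ∃ κ : Submodule F (Fin (n + 1) → F), Module.finrank F κ = k - 2 ∧ κ ≤ Sp ∧
    (∃ a : ZMod p, ∀ P : Pt F n, ptIn P κ → c P = a) ∧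
    ∃ π : Submodule F (Fin (n + 1) → F), IsPlane π ∧ π ≤ Sp ∧ π ⊓ κ = ⊥ ∧
      PlaneIsType p q c π t ∧
      ∀ P : Pt F n, ptIn P Sp → ¬ ptIn P κ →
        ∃ Q : Pt F n, ptIn Q π ∧
          Projectivization.submodule Q ≤ κ ⊔ Projectivization.submodule P ∧ c P = c Q

section Hankel
open Polynomial

variable {K : Type} [Field K] [Fintype K]

/-- The Hankel matrix of the moments `∑ x, x ^ k * G x` of a family of polynomials. -/
def hankel (G : K → K[X]) (α : ℕ) : Matrix (Fin α) (Fin α) K[X] :=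
  Matrix.of fun i j => ∑ x, C (x ^ ((i : ℕ) + (j : ℕ))) * G x

theorem natDegree_det_hankel_le (G : K → K[X]) (α : ℕ)
    (hG : ∀ k : ℕ, (∑ x, C (x ^ k) * G x).natDegree ≤ k) :
    (hankel G α).det.natDegree ≤ α * (α - 1) := by
  rw [Matrix.det_apply]
  refine natDegree_sum_le_of_forall_le _ _ fun σ _ => ?_
  refine (natDegree_smul_le _ _).trans ?_
  refine (natDegree_prod_le _ _).trans ?_
  calc ∑ i, (hankel G α (σ i) i).natDegree ≤ ∑ i : Fin α, (((σ i : Fin α) : ℕ) + (i : ℕ)) :=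
        Finset.sum_le_sum fun i _ => hG _
    _ = (∑ i : Fin α, (i : ℕ)) * 2 := by
        rw [Finset.sum_add_distrib, Equiv.sum_comp σ (fun i : Fin α => (i : ℕ)), mul_two]
    _ = α * (α - 1) := by
        rw [Fin.sum_univ_eq_sum_range (fun i => i), Finset.sum_range_id_mul_two]

theorem det_hankel_ne_zero (G : K → K[X]) (α : ℕ) (y : K)
    (hα : (Finset.univ.filter fun x => (G x).eval y ≠ 0).card = α) :
    (hankel G α).det ≠ 0 := by
  set S := Finset.univ.filter fun x => (G x).eval y ≠ 0 with hS
  let e : Fin α ≃ S := (Fintype.equivFinOfCardEq (by simpa using hα)).symm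
  let v : Fin α → K := fun i => (e i : K)
  have hv : Function.Injective v := Subtype.val_injective.comp e.injective
  have key : (evalRingHom y).mapMatrix (hankel G α) =
      (Matrix.vandermonde v).transpose *
        (Matrix.diagonal fun i => (G (v i)).eval y) * Matrix.vandermonde v := by
    ext i j
    rw [Matrix.mul_apply]
    simp only [hankel, RingHom.mapMatrix_apply, Matrix.map_apply, Matrix.of_apply,
      coe_evalRingHom, eval_finsetSum, eval_mul, eval_C, Matrix.mul_diagonal,
      Matrix.transpose_apply,
      Matrix.vandermonde_apply]
    rw [← Finset.sum_subset (Finset.subset_univ S), ← Finset.sum_coe_sort S, ← e.sum_comp]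
    · exact Finset.sum_congr rfl fun k _ => by rw [pow_add]; ring
    · intro x _ hx
      have : (G x).eval y = 0 := by simpa [hS] using hx
      rw [this, mul_zero]
  intro h0
  have h1 := congrArg (evalRingHom y) h0
  rw [RingHom.map_det, key, Matrix.det_mul, Matrix.det_mul, Matrix.det_transpose,
    Matrix.det_diagonal, map_zero] at h1
  have hV : (Matrix.vandermonde v).det ≠ 0 := Matrix.det_vandermonde_ne_zero_iff.mpr hv
  have hP : ∏ i, (G (v i)).eval y ≠ 0 := Finset.prod_ne_zero_iff.mpr fun i _ => by
    exact (Finset.mem_filter.mp (e i).2).2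
  exact mul_ne_zero (mul_ne_zero hV hP) hV h1

theorem pow_dvd_det_hankel (G : K → K[X]) (α : ℕ) (y : K) :
    (X - C y) ^ (α - (Finset.univ.filter fun x => (G x).eval y ≠ 0).card) ∣
      (hankel G α).det := by
  have hexp : (hankel G α).det = ∑ σ : Fin α → K,
      (∏ i, C (σ i ^ (i : ℕ)) * G (σ i)) •
        (Matrix.of fun i j : Fin α => C (σ i ^ (j : ℕ))).det := by
    have h1 : hankel G α = fun i : Fin α => ∑ x, (C (x ^ (i : ℕ)) * G x) •
        (fun j : Fin α => C (x ^ (j : ℕ))) := by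
      funext i j
      simp only [hankel, Matrix.of_apply, Finset.sum_apply, Pi.smul_apply, smul_eq_mul, pow_add,
        C_mul]
      exact Finset.sum_congr rfl fun x _ => by ring
    rw [h1]
    have h2 := (Matrix.detRowAlternating (R := K[X]) (n := Fin α)).toMultilinearMap.map_sum
      (fun (i : Fin α) (x : K) => (C (x ^ (i : ℕ)) * G x) • (fun j : Fin α => C (x ^ (j : ℕ))))
    refine h2.trans (Finset.sum_congr rfl fun σ _ => ?_)
    exact (Matrix.detRowAlternating (R := K[X]) (n := Fin α)).toMultilinearMap.map_smul_univ
      (fun i => C (σ i ^ (i : ℕ)) * G (σ i)) (fun i j => C (σ i ^ (j : ℕ)))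
  rw [hexp]
  refine Finset.dvd_sum fun σ _ => ?_
  by_cases hσ : Function.Injective σ
  · rw [smul_eq_mul, Finset.prod_mul_distrib]
    refine Dvd.dvd.mul_right (Dvd.dvd.mul_left ?_ _) _
    set Z := Finset.univ.filter fun i : Fin α => (G (σ i)).eval y = 0
    have hZ : α - (Finset.univ.filter fun x => (G x).eval y ≠ 0).card ≤ Z.card := by
      have h1 := Finset.card_filter_add_card_filter_not (s := (Finset.univ : Finset (Fin α)))
        (fun i => (G (σ i)).eval y = 0)
      have h2 : (Finset.univ.filter fun i : Fin α => ¬ (G (σ i)).eval y = 0).card ≤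
          (Finset.univ.filter fun x => (G x).eval y ≠ 0).card :=
        Finset.card_le_card_of_injOn σ (fun i hi => by simpa using hi) hσ.injOn
      rw [Finset.card_univ, Fintype.card_fin] at h1
      have : Z.card = (Finset.univ.filter fun i : Fin α => (G (σ i)).eval y = 0).card := rfl
      omega
    refine (pow_dvd_pow _ hZ).trans ?_
    have : (X - C y) ^ Z.card ∣ ∏ i ∈ Z, G (σ i) := by
      rw [← Finset.prod_const]
      exact Finset.prod_dvd_prod_of_dvd _ _ fun i hi =>
        dvd_iff_isRoot.mpr (by simpa [Z] using hi)
    exact this.trans (Finset.prod_dvd_prod_of_subset _ _ _ (Finset.subset_univ _))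
  · obtain ⟨i, j, hij, hne⟩ : ∃ i j, σ i = σ j ∧ i ≠ j := by
      simpa [Function.Injective] using hσ
    rw [Matrix.det_zero_of_row_eq hne (by funext k; simp [hij]), smul_zero]
    exact dvd_zero _

/-- If the moments of `G` have small degree, then the number of nonzero values of `G` cannot be
much smaller on the other lines `Y = y` than it is on the line `Y = y₀`. -/
theorem card_mul_le_sum_card_eval_ne_zero (G : K → K[X]) (α : ℕ) (y₀ : K)
    (hG : ∀ k : ℕ, (∑ x, C (x ^ k) * G x).natDegree ≤ k)
    (hα : (Finset.univ.filter fun x => (G x).eval y₀ ≠ 0).card = α) :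
    Fintype.card K * α ≤
      ∑ y, (Finset.univ.filter fun x => (G x).eval y ≠ 0).card + α * (α - 1) := by
  set N : K → ℕ := fun y => (Finset.univ.filter fun x => (G x).eval y ≠ 0).card
  have hne := det_hankel_ne_zero G α y₀ hα
  have hdvd : ∏ y : K, (X - C y) ^ (α - N y) ∣ (hankel G α).det := by
    refine Finset.prod_dvd_of_coprime (fun a _ b _ hab => ?_) fun y _ => pow_dvd_det_hankel G α y
    exact (pairwise_coprime_X_sub_C (K := K) (s := id) Function.injective_id hab).pow
  have h1 := natDegree_le_of_dvd hdvd hne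
  rw [natDegree_prod_of_monic _ _ fun y _ => (monic_X_sub_C y).pow _] at h1
  simp only [natDegree_pow, natDegree_X_sub_C, mul_one] at h1
  have h2 := h1.trans (natDegree_det_hankel_le G α hG)
  calc Fintype.card K * α = ∑ _y : K, α := by simp
    _ ≤ ∑ y, (N y + (α - N y)) := Finset.sum_le_sum fun y _ => by omega
    _ ≤ _ := by rw [Finset.sum_add_distrib]; exact Nat.add_le_add_left h2 _

end Hankel

section VectorCode
open Polynomial

/-- Functions on a vector space spanned by the indicator functions of kernels of linear forms. -/
def vcode (F : Type) [Field F] (p : ℕ) (V : Type) [AddCommGroup V] [Module F V] :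
    Submodule (ZMod p) (V → ZMod p) :=
  Submodule.span (ZMod p)
    {g | ∃ φ : Module.Dual F V, g = fun v => if φ v = 0 then (1 : ZMod p) else 0}

variable {K : Type} [Field K] {p : ℕ} {U V : Type} [AddCommGroup U] [Module K U]
  [AddCommGroup V] [Module K V]

theorem comp_mem_vcode (L : U →ₗ[K] V) {g : V → ZMod p} (hg : g ∈ vcode K p V) :
    g ∘ L ∈ vcode K p U := by
  induction hg using Submodule.span_induction with
  | mem g hg =>
    obtain ⟨φ, rfl⟩ := hg
    exact Submodule.subset_span ⟨φ.comp L, rfl⟩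
  | zero => exact Submodule.zero_mem _
  | add g g' _ _ h h' => exact Submodule.add_mem _ h h'
  | smul a g _ h => exact Submodule.smul_mem _ a h

theorem vcode_smul {g : V → ZMod p} (hg : g ∈ vcode K p V) {a : K} (ha : a ≠ 0) (v : V) :
    g (a • v) = g v := by
  induction hg using Submodule.span_induction with
  | mem g hg =>
    obtain ⟨φ, rfl⟩ := hg
    simp [ha]
  | zero => rfl
  | add g g' _ _ h h' => simp only [Pi.add_apply, h, h']
  | smul b g _ h => simp only [Pi.smul_apply, h]

theorem vcode_rep_mk {g : V → ZMod p} (hg : g ∈ vcode K p V) (v : V) (hv : v ≠ 0) :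
    g (Projectivization.mk K v hv).rep = g v := by
  obtain ⟨a, ha⟩ := Projectivization.exists_smul_eq_mk_rep K v hv
  rw [← ha]
  exact vcode_smul hg a.ne_zero v

theorem sum_eval_eq_zero [Fintype K] (P : K[X]) (hP : P.natDegree < Fintype.card K - 1) :
    ∑ x, P.eval x = 0 := by
  simp only [eval_eq_sum_range]
  rw [Finset.sum_comm]
  refine Finset.sum_eq_zero fun i hi => ?_
  rw [← Finset.mul_sum, FiniteField.sum_pow_lt_card_sub_one, mul_zero]
  have := Finset.mem_range.mp hi
  omega

theorem natDegree_moment_pow_le [Fintype K] (a b d : K) (k : ℕ) :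
    (∑ x : K, C (x ^ k) * (C (a * x + d) + C b * X) ^ (Fintype.card K - 1)).natDegree ≤ k := by
  set N := Fintype.card K - 1
  have h : ∑ x : K, C (x ^ k) * (C (a * x + d) + C b * X) ^ N =
      ∑ j ∈ Finset.range (N + 1), C ((∑ x : K, x ^ k * (a * x + d) ^ j) * b ^ (N - j) *
        (N.choose j : K)) * X ^ (N - j) := by
    have e : ∀ x : K, (C (a * x + d) + C b * X) ^ N = ∑ j ∈ Finset.range (N + 1),
        C (a * x + d) ^ j * (C b * X) ^ (N - j) * (N.choose j : K[X]) := fun x => add_pow _ _ _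
    simp only [e, Finset.mul_sum, Finset.sum_mul, map_sum]
    rw [Finset.sum_comm]
    refine Finset.sum_congr rfl fun j _ => Finset.sum_congr rfl fun x _ => ?_
    simp only [C_mul, C_pow, mul_pow, C_add, map_natCast]
    ring
  rw [h]
  refine natDegree_sum_le_of_forall_le _ _ fun j hj => ?_
  by_cases hjk : N - j ≤ k
  · exact (natDegree_C_mul_X_pow_le _ _).trans hjk
  · have h0 : ∑ x : K, x ^ k * (a * x + d) ^ j = 0 := by
      have := sum_eval_eq_zero (X ^ k * (C a * X + C d) ^ j) (by
        refine lt_of_le_of_lt (natDegree_mul_le_of_le (natDegree_X_pow_le k)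
          (natDegree_pow_le_of_le j natDegree_linear_le)) ?_
        have : N = Fintype.card K - 1 := rfl
        omega)
      simpa using this
    simp [h0]

theorem exists_polynomial_of_mem_vcode [Fintype K] [CharP K p] {g : V → ZMod p}
    (hg : g ∈ vcode K p V) (f₀ f₁ f₂ : V) :
    ∃ G : K → K[X], (∀ k : ℕ, (∑ x, C (x ^ k) * G x).natDegree ≤ k) ∧
      ∀ x y, (G x).eval y = ZMod.castHom dvd_rfl K (g (x • f₀ + y • f₂ + f₁)) := by
  induction hg using Submodule.span_induction with
  | mem g hg =>
    obtain ⟨φ, rfl⟩ := hg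
    refine ⟨fun x => 1 - (C (φ f₀ * x + φ f₁) + C (φ f₂) * X) ^ (Fintype.card K - 1),
      fun k => ?_, fun x y => ?_⟩
    · simp only [mul_sub, mul_one, Finset.sum_sub_distrib]
      refine (natDegree_sub_le_of_le (m := k) (n := k) ?_ (natDegree_moment_pow_le _ _ _ _)).trans
        (max_self k).le
      rw [← map_sum]
      exact (natDegree_C _).trans_le (Nat.zero_le k)
    · have h1 : φ f₀ * x + φ f₁ + φ f₂ * y = φ (x • f₀ + y • f₂ + f₁) := by
        simp only [map_add, map_smul, smul_eq_mul]; ring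
      simp only [eval_sub, eval_one, eval_pow, eval_add, eval_mul, eval_C, eval_X, h1]
      split_ifs with h
      · have : Fintype.card K - 1 ≠ 0 := by have := Fintype.one_lt_card (α := K); omega
        simp [h, this]
      · rw [FiniteField.pow_card_sub_one_eq_one _ h]
        simp
  | zero => exact ⟨fun _ => 0, fun k => by simp, fun x y => by simp⟩
  | add g g' _ _ h h' =>
    obtain ⟨G, hG, hG'⟩ := h
    obtain ⟨H, hH, hH'⟩ := h'
    refine ⟨fun x => G x + H x, fun k => ?_, fun x y => ?_⟩
    · simp only [mul_add, Finset.sum_add_distrib]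
      exact (natDegree_add_le_of_le (hG k) (hH k)).trans (max_self k).le
    · simp only [eval_add, hG', hH', Pi.add_apply, map_add]
  | smul a g _ h =>
    obtain ⟨G, hG, hG'⟩ := h
    refine ⟨fun x => C (ZMod.castHom dvd_rfl K a) * G x, fun k => ?_, fun x y => ?_⟩
    · simp only [mul_left_comm _ (C (ZMod.castHom dvd_rfl K a)), ← Finset.mul_sum]
      exact (natDegree_C_mul_le _ _).trans (hG k)
    · simp only [eval_mul, eval_C, hG', Pi.smul_apply, smul_eq_mul, map_mul]

end VectorCode

section PlaneCode

variable {K : Type} [Field K] {p : ℕ}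

/-- In affine coordinates: if `g` vanishes at `f₀` then the line `⟨f₀, f₁⟩` cannot have an
intermediate number of nonzeros of `g` unless `g` has many nonzeros elsewhere. -/
theorem card_mul_le_card_affine [Fintype K] [Fact p.Prime] [CharP K p] {V : Type}
    [AddCommGroup V] [Module K V] {g : V → ZMod p}
    (hg : g ∈ vcode K p V) (f₀ f₁ f₂ : V) (α : ℕ)
    (hα : (Finset.univ.filter fun x : K => g (x • f₀ + f₁) ≠ 0).card = α) :
    α * (Fintype.card K - α) ≤ (Finset.univ.filter fun z : K × K =>
      z.2 ≠ 0 ∧ g (z.1 • f₀ + z.2 • f₂ + f₁) ≠ 0).card := by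
  obtain ⟨G, hG, hG'⟩ := exists_polynomial_of_mem_vcode hg f₀ f₁ f₂
  have hev : ∀ x y, (G x).eval y ≠ 0 ↔ g (x • f₀ + y • f₂ + f₁) ≠ 0 := fun x y => by
    rw [hG', Ne, map_eq_zero]
  have h := card_mul_le_sum_card_eval_ne_zero G α 0 hG (by simpa [hev] using hα)
  simp only [hev] at h
  have hsum : ∑ y ∈ Finset.univ.erase (0 : K),
      (Finset.univ.filter fun x : K => g (x • f₀ + y • f₂ + f₁) ≠ 0).card =
      (Finset.univ.filter fun z : K × K =>
        z.2 ≠ 0 ∧ g (z.1 • f₀ + z.2 • f₂ + f₁) ≠ 0).card := by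
    rw [Finset.card_eq_sum_card_fiberwise (f := Prod.snd) (t := Finset.univ.erase (0 : K))
      (fun z hz => by simpa using (Finset.mem_filter.mp hz).2.1)]
    refine Finset.sum_congr rfl fun y hy => ?_
    refine Finset.card_bij (fun x _ => (x, y)) (fun x hx => ?_) (fun x _ x' _ h => by simpa using h)
      (fun z hz => ?_)
    · simpa [Finset.ne_of_mem_erase hy] using hx
    · simp only [Finset.mem_filter, Finset.mem_univ, true_and] at hz
      refine ⟨z.1, ?_, by rw [← hz.2]⟩
      simpa [← hz.2] using hz.1.2
  rw [← Finset.add_sum_erase _ _ (Finset.mem_univ (0 : K)), hsum] at h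
  simp only [zero_smul, add_zero, hα] at h
  rcases Nat.eq_zero_or_pos α with rfl | hpos
  · simp
  have hle : α ≤ Fintype.card K := by
    rw [← hα, ← Finset.card_univ]; exact Finset.card_filter_le _ _
  obtain ⟨t, ht⟩ := Nat.exists_eq_add_of_le hle
  obtain ⟨s, rfl⟩ : ∃ s, α = s + 1 := ⟨α - 1, by omega⟩
  rw [ht] at h ⊢
  simp only [Nat.add_sub_cancel_left, Nat.add_sub_cancel] at h ⊢
  nlinarith [h]

open Configuration Projectivization Configuration.ofField

abbrev Pl (K : Type) [Field K] := Projectivization K (Fin 3 → K)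

instance [Fintype K] : Fintype (Pl K) := Fintype.ofFinite _

theorem mem_iff_rep (P l : Pl K) : P ∈ l ↔ P.rep ⬝ᵥ l.rep = 0 := by
  conv_lhs => rw [← P.mk_rep, ← l.mk_rep]
  exact Iff.rfl

theorem mk_mem_iff (v : Fin 3 → K) (hv : v ≠ 0) (l : Pl K) :
    Projectivization.mk K v hv ∈ l ↔ v ⬝ᵥ l.rep = 0 := by
  conv_lhs => rw [← l.mk_rep]
  exact Iff.rfl

theorem order_eq [Fintype K] : ProjectivePlane.order (Pl K) (Pl K) = Fintype.card K := by
  have h1 := ProjectivePlane.card_points (Pl K) (Pl K)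
  have h2 := Projectivization.card_of_finrank K (Fin 3 → K) (n := 3) (by simp)
  rw [← Nat.card_eq_fintype_card, h2, Nat.card_eq_fintype_card] at h1
  simp only [Finset.sum_range_succ, Finset.sum_range_zero, pow_zero, pow_one] at h1
  set a := ProjectivePlane.order (Pl K) (Pl K)
  set b := Fintype.card K
  have h3 : b ^ 2 + b = a ^ 2 + a := by omega
  nlinarith [h3, sq_nonneg ((a:ℤ) - b), mul_self_nonneg a]

theorem card_line {P L : Type} [Membership P L] [Fintype P] [Fintype L] [ProjectivePlane P L]
    (l : L) : (Finset.univ.filter fun X : P => X ∈ l).card = ProjectivePlane.order P L + 1 := by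
  rw [← ProjectivePlane.pointCount_eq (P := P) l, pointCount, Nat.card_eq_fintype_card,
    Fintype.card_subtype]

theorem sum_line_eq [Fintype K] [CharP K p] [Fact p.Prime] {g : (Fin 3 → K) → ZMod p}
    (hg : g ∈ vcode K p (Fin 3 → K)) :
    ∃ κ, ∀ l : Pl K, ∑ X : Pl K with X ∈ l, g X.rep = κ := by
  have hq : ((Fintype.card K : ℕ) : ZMod p) = 0 := by
    rw [ZMod.natCast_eq_zero_iff, ← CharP.cast_eq_zero_iff K p]
    exact FiniteField.cast_card_eq_zero K
  induction hg using Submodule.span_induction with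
  | mem g hg =>
    obtain ⟨φ, rfl⟩ := hg
    refine ⟨1, fun l => ?_⟩
    simp only [Finset.sum_ite, Finset.sum_const_zero, add_zero, Finset.sum_const, nsmul_eq_mul,
      mul_one]
    have hφ : ∀ v, φ v = v ⬝ᵥ (fun i => φ (Pi.single i 1)) := fun v => by
      conv_lhs => rw [← Finset.univ_sum_single v]
      simp only [map_sum, dotProduct]
      refine Finset.sum_congr rfl fun i _ => ?_
      rw [← smul_eq_mul, ← map_smul, ← Pi.single_smul', smul_eq_mul, mul_one]
    by_cases hw : (fun i => φ (Pi.single i 1)) = 0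
    · have : ∀ v, φ v = 0 := fun v => by rw [hφ, hw, dotProduct_zero]
      simp [this, card_line, order_eq, hq]
    · set m := Projectivization.mk K _ hw with hm
      have hmem : ∀ X : Pl K, φ X.rep = 0 ↔ X ∈ m := fun X => by
        rw [hφ]
        conv_rhs => rw [← X.mk_rep]
        exact Iff.rfl
      simp only [hmem]
      by_cases hlm : l = m
      · subst hlm
        rw [Finset.filter_true_of_mem (fun X hX => (Finset.mem_filter.mp hX).2)]
        simp [card_line, order_eq, hq]
      · obtain ⟨Q, ⟨hQl, hQm⟩, hQ⟩ := HasPoints.existsUnique_point (Pl K) (Pl K) l m hlm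
        rw [Finset.card_eq_one.mpr ⟨Q, ?_⟩, Nat.cast_one]
        ext X
        simp only [Finset.mem_filter, Finset.mem_univ, true_and, Finset.mem_singleton]
        exact ⟨fun h => hQ X h, by rintro rfl; exact ⟨hQl, hQm⟩⟩
  | zero => exact ⟨0, by simp⟩
  | add g g' _ _ h h' =>
    obtain ⟨κ, h⟩ := h
    obtain ⟨κ', h'⟩ := h'
    exact ⟨κ + κ', fun l => by simp [Finset.sum_add_distrib, h, h']⟩
  | smul a g _ h =>
    obtain ⟨κ, h⟩ := h
    exact ⟨a * κ, fun l => by simp [← Finset.mul_sum, h]⟩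

/-- If a value `a` occurs on a line with intermediate multiplicity, then there are many nonzeros
off this line. -/
theorem card_value_mul_le [Fintype K] [CharP K p] [Fact p.Prime] {g : (Fin 3 → K) → ZMod p}
    (hg : g ∈ vcode K p (Fin 3 → K)) (l : Pl K) (a : ZMod p)
    (hpos : ∃ X ∈ l, g X.rep = a) :
    (Fintype.card K + 1 - (Finset.univ.filter fun X : Pl K => X ∈ l ∧ g X.rep = a).card) *
      ((Finset.univ.filter fun X : Pl K => X ∈ l ∧ g X.rep = a).card - 1) ≤
      (Finset.univ.filter fun X : Pl K => X ∉ l ∧ g X.rep ≠ 0).card := by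
  obtain ⟨A, hA, hAa⟩ := hpos
  have hline := card_line (P := Pl K) l
  rw [order_eq] at hline
  have hK := Fintype.one_lt_card (α := K)
  obtain ⟨B, hB, hBA⟩ : ∃ B, B ∈ l ∧ B ≠ A := by
    obtain ⟨B, hB, hne⟩ := Finset.exists_mem_ne (by rw [hline]; omega) A
    exact ⟨B, (Finset.mem_filter.mp hB).2, hne⟩
  obtain ⟨R, hR⟩ : ∃ R, R ∉ l := Nondegenerate.exists_point l
  have hind : ∀ s t : K, s • A.rep + t • B.rep = 0 → s = 0 ∧ t = 0 :=
    LinearIndependent.pair_iff.mp (by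
      have h := independent_iff.mp ((independent_pair_iff_ne A B).mpr hBA.symm)
      rwa [show Projectivization.rep ∘ ![A, B] = ![A.rep, B.rep] from
        funext fun i => by fin_cases i <;> rfl] at h)
  set φ : Module.Dual K (Fin 3 → K) := dotProductBilin K K l.rep
  have hφ : ∀ X : Pl K, X ∈ l ↔ φ X.rep = 0 := fun X => by
    rw [mem_iff_rep, dotProduct_comm]; exact Iff.rfl
  have hφmk : ∀ v hv, Projectivization.mk K v hv ∈ l ↔ φ v = 0 := fun v hv => by
    rw [mk_mem_iff, dotProduct_comm]; exact Iff.rfl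
  rw [hφ] at hA hB hR
  set g' : (Fin 3 → K) → ZMod p := g - a • fun v => if φ v = 0 then 1 else 0
  have hg' : g' ∈ vcode K p (Fin 3 → K) :=
    Submodule.sub_mem _ hg (Submodule.smul_mem _ _ (Submodule.subset_span ⟨φ, rfl⟩))
  have hon : ∀ v, φ v = 0 → g' v = g v - a := fun v h => by simp [g', h]
  have hoff : ∀ v, φ v ≠ 0 → g' v = g v := fun v h => by simp [g', h]
  have hne : ∀ x y : K, x • A.rep + y • R.rep + B.rep ≠ 0 := fun x y h => by
    have h1 := congrArg φ h
    simp only [map_add, map_smul, hA, hB, mul_zero, zero_add, add_zero, map_zero, smul_eq_mul,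
      mul_eq_zero, hR, or_false] at h1
    rw [h1, zero_smul, add_zero] at h
    exact one_ne_zero (hind x 1 (by rwa [one_smul])).2
  let ψ : K × K → Pl K := fun z => Projectivization.mk K _ (hne z.1 z.2)
  have hψl : ∀ z, ψ z ∈ l ↔ z.2 = 0 := fun z => by
    rw [hφmk]
    simp [hA, hB, hR]
  have hψ : Function.Injective ψ := by
    rintro ⟨x, y⟩ ⟨x', y'⟩ h
    obtain ⟨c, hc⟩ := (Projectivization.mk_eq_mk_iff' K _ _ _ _).mp h
    have h1 := congrArg φ hc
    simp only [map_add, map_smul, hA, hB, mul_zero, zero_add, add_zero, smul_eq_mul,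
      ← mul_assoc, mul_left_inj' hR] at h1
    subst h1
    obtain ⟨h2, h3⟩ := hind (c * x' - x) (c - 1) (by
      rw [← sub_eq_zero] at hc
      rw [← hc]
      module)
    obtain rfl : c = 1 := by linear_combination h3
    exact Prod.ext (by linear_combination -h2) (by simp)
  have hgψ : ∀ z, g (ψ z).rep = g (z.1 • A.rep + z.2 • R.rep + B.rep) := fun z =>
    vcode_rep_mk hg _ _
  have himg : (Finset.univ.image fun x : K => ψ (x, 0)) =
      (Finset.univ.filter fun X : Pl K => X ∈ l).erase A := by
    refine Finset.eq_of_subset_of_card_le (fun X hX => ?_) ?_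
    · obtain ⟨x, -, rfl⟩ := Finset.mem_image.mp hX
      refine Finset.mem_erase.mpr ⟨fun h => ?_, by simp [hψl]⟩
      rw [← A.mk_rep] at h
      obtain ⟨c, hc⟩ := (Projectivization.mk_eq_mk_iff' K _ _ _ _).mp h
      exact one_ne_zero (hind (x - c) 1 (by
        rw [← sub_eq_zero] at hc
        rw [← neg_zero, ← hc]
        module)).2
    · rw [Finset.card_erase_of_mem (by simpa [hφ] using hA), hline, Finset.card_image_of_injective _
        (fun x x' h => (Prod.ext_iff.mp (hψ h)).1), Finset.card_univ, Nat.add_sub_cancel]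
  have hα : (Finset.univ.filter fun x : K => g' (x • A.rep + B.rep) ≠ 0).card =
      Fintype.card K + 1 - (Finset.univ.filter fun X : Pl K => X ∈ l ∧ g X.rep = a).card := by
    have h1 : (Finset.univ.filter fun X : Pl K => X ∈ l ∧ ¬ g X.rep = a) =
        (Finset.univ.image fun x : K => ψ (x, 0)).filter fun X => ¬ g X.rep = a := by
      rw [himg]
      ext X
      simp only [Finset.mem_filter, Finset.mem_univ, true_and, Finset.mem_erase]
      exact ⟨fun h => ⟨⟨fun h' => h.2 (h' ▸ hAa), h.1⟩, h.2⟩, fun h => ⟨h.1.2, h.2⟩⟩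
    have h2 := Finset.card_filter_add_card_filter_not
      (s := (Finset.univ.filter fun X : Pl K => X ∈ l)) (fun X => g X.rep = a)
    rw [Finset.filter_filter, Finset.filter_filter, hline, h1, Finset.filter_image,
      Finset.card_image_of_injective _ (fun x x' h => (Prod.ext_iff.mp (hψ h)).1)] at h2
    rw [← h2, Nat.add_sub_cancel_left]
    congr 1
    ext x
    simp [hon, hA, hB, hgψ, sub_eq_zero]
  have hmain := card_mul_le_card_affine hg' A.rep B.rep R.rep _ hα
  have hle : (Finset.univ.filter fun X : Pl K => X ∈ l ∧ g X.rep = a).card ≤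
      Fintype.card K + 1 := by
    rw [← hline, ← Finset.filter_filter]
    exact Finset.card_filter_le _ _
  rw [show Fintype.card K - (Fintype.card K + 1 -
    (Finset.univ.filter fun X : Pl K => X ∈ l ∧ g X.rep = a).card) =
    (Finset.univ.filter fun X : Pl K => X ∈ l ∧ g X.rep = a).card - 1 by omega] at hmain
  refine hmain.trans (Finset.card_le_card_of_injOn ψ (fun z hz => ?_) hψ.injOn)
  simp only [Finset.coe_filter, Finset.mem_univ, true_and, Set.mem_ofPred_eq] at hz ⊢
  refine ⟨by rw [hψl]; exact hz.1, ?_⟩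
  rw [hgψ, ← hoff _ (by simp [hA, hB, hR, hz.1])]
  exact hz.2

end PlaneCode

section PlaneCombinatorics
open Configuration ProjectivePlane

variable {P L M : Type} [Membership P L] [Zero M]

/-- The points of a line at which `f` does not vanish. -/
def onSupp [Fintype P] (f : P → M) (l : L) : Finset P :=
  Finset.univ.filter fun X => X ∈ l ∧ f X ≠ 0

/-- The points off a line at which `f` does not vanish. -/
def offSupp [Fintype P] (f : P → M) (l : L) : Finset P :=
  Finset.univ.filter fun X => X ∉ l ∧ f X ≠ 0

theorem mem_onSupp [Fintype P] {f : P → M} {l : L} {X : P} :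
    X ∈ onSupp f l ↔ X ∈ l ∧ f X ≠ 0 := by
  simp [onSupp]

theorem mem_offSupp [Fintype P] {f : P → M} {l : L} {X : P} :
    X ∈ offSupp f l ↔ X ∉ l ∧ f X ≠ 0 := by
  simp [offSupp]

theorem sum_onSupp [Fintype P] {M : Type} [AddCommMonoid M] (f : P → M) (l : L) :
    ∑ X ∈ onSupp f l, f X = ∑ X : P with X ∈ l, f X := by
  refine Finset.sum_subset (fun X hX => ?_) fun X hX hX' => ?_
  · simpa using (mem_onSupp.mp hX).1
  · by_contra h
    exact hX' (mem_onSupp.mpr ⟨by simpa using hX, h⟩)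

variable [ProjectivePlane P L]

theorem eq_line_of_mem {A B : P} {l m : L} (h : A ≠ B) (hAl : A ∈ l) (hBl : B ∈ l) (hAm : A ∈ m)
    (hBm : B ∈ m) : l = m :=
  (Nondegenerate.eq_or_eq hAl hBl hAm hBm).resolve_left h

theorem eq_point_of_mem {A B : P} {l m : L} (h : l ≠ m) (hAl : A ∈ l) (hBl : B ∈ l) (hAm : A ∈ m)
    (hBm : B ∈ m) : A = B :=
  (Nondegenerate.eq_or_eq hAl hBl hAm hBm).resolve_right h

theorem exists_line (A B : P) (h : A ≠ B) : ∃ l : L, A ∈ l ∧ B ∈ l :=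
  ⟨HasLines.mkLine h, HasLines.mkLine_ax h⟩

theorem exists_point (l m : L) (h : l ≠ m) : ∃ A : P, A ∈ l ∧ A ∈ m :=
  ⟨HasPoints.mkPoint h, HasPoints.mkPoint_ax h⟩

theorem card_other_lines [Fintype P] [Fintype L] {A : P} {s : L} (hA : A ∈ s) :
    (Finset.univ.filter fun m : L => A ∈ m ∧ m ≠ s).card = order P L := by
  have h : (Finset.univ.filter fun m : L => A ∈ m).card = order P L + 1 := by
    rw [← lineCount_eq (L := L) A, lineCount, Nat.card_eq_fintype_card, Fintype.card_subtype]
  have h2 : (Finset.univ.filter fun m : L => A ∈ m ∧ m ≠ s) =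
      (Finset.univ.filter fun m : L => A ∈ m).erase s := by
    ext m
    simp [and_comm]
  rw [h2, Finset.card_erase_of_mem (by simpa using hA), h, Nat.add_sub_cancel]

/-- The other lines through a point of `s` partition the points off `s`. -/
theorem sum_card_other_lines [Fintype L] {A : P} {s : L} (hA : A ∈ s) {T : Finset P}
    (hT : ∀ X ∈ T, X ∉ s) :
    ∑ m : L with A ∈ m ∧ m ≠ s, (T.filter fun X => X ∈ m).card = T.card := by
  simp only [Finset.card_filter]
  rw [Finset.sum_comm, Finset.card_eq_sum_ones]
  refine Finset.sum_congr rfl fun X hX => ?_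
  have hAX : A ≠ X := fun h => hT X hX (h ▸ hA)
  obtain ⟨m, hAm, hXm⟩ := exists_line (L := L) A X hAX
  rw [Finset.sum_eq_single m, if_pos hXm]
  · intro m' hm' hne
    rw [if_neg]
    exact fun h => hne (eq_line_of_mem hAX (Finset.mem_filter.mp hm').2.1 h hAm hXm)
  · intro h
    exact absurd (Finset.mem_filter.mpr ⟨Finset.mem_univ _, hAm, fun h => hT X hX (h ▸ hXm)⟩) h

theorem onSupp_eq_union [Fintype P] {A : P} {s m : L} (hAs : A ∈ s) (hAm : A ∈ m) (hms : m ≠ s)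
    (f : P → M) :
    onSupp f m = (if f A = 0 then ∅ else {A}) ∪ (offSupp f s).filter fun X => X ∈ m := by
  ext X
  simp only [mem_onSupp, Finset.mem_union, Finset.mem_filter, mem_offSupp]
  constructor
  · rintro ⟨hX, hf⟩
    by_cases hXs : X ∈ s
    · obtain rfl : X = A := eq_point_of_mem hms hX hAm hXs hAs
      left
      simp [hf]
    · exact Or.inr ⟨⟨hXs, hf⟩, hX⟩
  · rintro (h | h)
    · split_ifs at h with h0
      · simp at h
      · obtain rfl := Finset.mem_singleton.mp h
        exact ⟨hAm, h0⟩
    · exact ⟨h.2, h.1.2⟩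

theorem card_onSupp_eq [Fintype P] {A : P} {s m : L} (hAs : A ∈ s) (hAm : A ∈ m) (hms : m ≠ s)
    {f : P → M} (hA : f A ≠ 0) :
    (onSupp f m).card = ((offSupp f s).filter fun X => X ∈ m).card + 1 := by
  rw [onSupp_eq_union hAs hAm hms, if_neg hA, Finset.card_union_of_disjoint, add_comm,
    Finset.card_singleton]
  simp [mem_offSupp, hAs]

theorem sum_offSupp_line [Fintype P] {A : P} {s m : L} (hAs : A ∈ s) (hAm : A ∈ m) (hms : m ≠ s)
    {M : Type} [AddCommGroup M] {f : P → M} {κ : M}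
    (hκ : ∀ l : L, ∑ X : P with X ∈ l, f X = κ) :
    ∑ X ∈ (offSupp f s).filter fun X => X ∈ m, f X = κ - f A := by
  rw [← hκ m, eq_sub_iff_add_eq, ← sum_onSupp, onSupp_eq_union hAs hAm hms, Finset.sum_union,
    add_comm]
  · congr 1
    split_ifs with h <;> simp [h]
  · split_ifs <;> simp [mem_offSupp, hAs]

/-- The lines joining a point `t` off `s` to the points of `s` partition the points other
than `t`. -/
theorem sum_card_joining_lines [Fintype P] {s : L} {t : P} (ht : t ∉ s) {ℓ : P → L}
    (hℓ : ∀ A ∈ s, A ∈ ℓ A ∧ t ∈ ℓ A) {T : Finset P} (hT : t ∉ T) :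
    ∑ A : P with A ∈ s, (T.filter fun X => X ∈ ℓ A).card = T.card := by
  simp only [Finset.card_filter]
  rw [Finset.sum_comm, Finset.card_eq_sum_ones]
  refine Finset.sum_congr rfl fun X hX => ?_
  have htX : t ≠ X := fun h => hT (h ▸ hX)
  obtain ⟨m, htm, hXm⟩ := exists_line (L := L) t X htX
  have hms : m ≠ s := fun h => ht (h ▸ htm)
  obtain ⟨A, hAm, hAs⟩ := exists_point (P := P) m s hms
  have hAt : A ≠ t := fun h => ht (h ▸ hAs)
  rw [Finset.sum_eq_single A, if_pos]
  · exact eq_line_of_mem hAt hAm htm (hℓ A hAs).1 (hℓ A hAs).2 ▸ hXm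
  · intro B hB hne
    rw [if_neg]
    have hBs := (Finset.mem_filter.mp hB).2
    intro h
    obtain rfl := eq_line_of_mem htX htm hXm (hℓ B hBs).2 h
    exact hne (eq_point_of_mem hms (hℓ B hBs).1 hAm hBs hAs)
  · intro h
    exact absurd (Finset.mem_filter.mpr ⟨Finset.mem_univ _, hAs⟩) h

theorem card_mul_le_card_add_choose [Fintype P] {f : P → M} {r : ℕ} (𝓜 : Finset L)
    (h : ∀ m ∈ 𝓜, r ≤ (onSupp f m).card) :
    𝓜.card * r ≤ (𝓜.biUnion fun m => onSupp f m).card + 𝓜.card.choose 2 := by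
  induction 𝓜 using Finset.induction_on with
  | empty => simp
  | insert l 𝓜 hl ih =>
    rw [Finset.biUnion_insert, Finset.card_insert_of_notMem hl, Nat.choose_succ_succ' _ 1,
      Nat.choose_one_right]
    have h1 := ih fun m hm => h m (Finset.mem_insert_of_mem hm)
    have h2 := h l (Finset.mem_insert_self _ _)
    have h3 := Finset.card_union_add_card_inter (onSupp f l) (𝓜.biUnion fun m => onSupp f m)
    have h4 : (onSupp f l ∩ 𝓜.biUnion fun m => onSupp f m).card ≤ 𝓜.card := by
      rw [Finset.inter_biUnion]
      refine (Finset.card_biUnion_le_card_mul _ _ 1 fun m hm => ?_).trans (mul_one _).le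
      refine Finset.card_le_one.mpr fun X hX Y hY => ?_
      simp only [Finset.mem_inter, mem_onSupp] at hX hY
      exact eq_point_of_mem (fun h => hl (h ▸ hm) : l ≠ m) hX.1.1 hY.1.1 hX.2.1 hY.2.1
    nlinarith

end PlaneCombinatorics

section PlaneTheorems
open Configuration ProjectivePlane

variable {P L : Type} [Membership P L] [Fintype P] [Fintype L] [ProjectivePlane P L] {p : ℕ}
  [Fact p.Prime] {f : P → ZMod p} {κ : ZMod p} {s : L}

theorem card_zeros {l : L} (f : P → ZMod p) :
    (Finset.univ.filter fun X => X ∈ l ∧ f X = 0).card + (onSupp f l).card = order P L + 1 := by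
  rw [← card_line (P := P) l, ← Finset.card_filter_add_card_filter_not
    (s := Finset.univ.filter fun X => X ∈ l) (fun X => f X = 0), Finset.filter_filter,
    Finset.filter_filter]
  congr! 2
  ext X
  simp [mem_onSupp]

/-- Two zeros of a `(q-1)`-secant. -/
theorem exists_two_zeros (hs : (onSupp f s).card + 1 = order P L) :
    ∃ A B, A ≠ B ∧ A ∈ s ∧ f A = 0 ∧ B ∈ s ∧ f B = 0 := by
  have h := card_zeros (l := s) f
  obtain ⟨A, hA, B, hB, hAB⟩ := Finset.one_lt_card.mp
    (show 1 < (Finset.univ.filter fun X => X ∈ s ∧ f X = 0).card by omega)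
  simp only [Finset.mem_filter, Finset.mem_univ, true_and] at hA hB
  exact ⟨A, B, hAB, hA.1, hA.2, hB.1, hB.2⟩

theorem exists_long_line {h : ℕ} (hq : order P L = p ^ h) (hq5 : 5 ≤ order P L)
    (hκ : ∀ l : L, ∑ X : P with X ∈ l, f X = κ)
    (hmul : ∀ a, (∃ X ∈ s, f X = a) →
      (order P L + 1 - (Finset.univ.filter fun X => X ∈ s ∧ f X = a).card) *
        ((Finset.univ.filter fun X => X ∈ s ∧ f X = a).card - 1) ≤ (offSupp f s).card)
    (hs : (onSupp f s).card + 1 = order P L) {A : P} (hA : A ∈ onSupp f s) :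
    ∃ m : L, A ∈ m ∧ m ≠ s ∧ 2 < (onSupp f m).card := by
  by_contra! hcon
  rw [mem_onSupp] at hA
  set T := offSupp f s with hT
  have hTs : ∀ X ∈ T, X ∉ s := fun X hX => (mem_offSupp.mp hX).1
  have hk : ∀ m : L, A ∈ m → m ≠ s → (T.filter fun X => X ∈ m).card ≤ 1 := fun m hm hms => by
    have := hcon m hm hms
    rw [card_onSupp_eq hA.1 hm hms hA.2, ← hT] at this
    omega
  have hTle : T.card ≤ order P L := by
    rw [← sum_card_other_lines hA.1 hTs, ← card_other_lines hA.1, Finset.card_eq_sum_ones]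
    exact Finset.sum_le_sum fun m hm =>
      hk m (Finset.mem_filter.mp hm).2.1 (Finset.mem_filter.mp hm).2.2
  obtain ⟨B, C, hBC, hB, hB0, hC, hC0⟩ := exists_two_zeros hs
  have hz := card_zeros (l := s) f
  have hTge : order P L - 1 ≤ T.card := by
    have := hmul 0 ⟨B, hB, hB0⟩
    rwa [show (Finset.univ.filter fun X => X ∈ s ∧ f X = 0).card = 2 by omega,
      show order P L + 1 - 2 = order P L - 1 by omega, Nat.mul_one] at this
  have hle2 : ∀ a : ZMod p, (Finset.univ.filter fun X => X ∈ s ∧ f X = a).card ≤ 2 := by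
    intro a
    by_contra! h3
    obtain ⟨X, hX⟩ := Finset.card_pos.mp (by omega :
      0 < (Finset.univ.filter fun X => X ∈ s ∧ f X = a).card)
    simp only [Finset.mem_filter, Finset.mem_univ, true_and] at hX
    have h4 := (hmul a ⟨X, hX⟩).trans hTle
    have ha : a ≠ 0 := by rintro rfl; omega
    have h5 : (Finset.univ.filter fun X => X ∈ s ∧ f X = a).card ≤ (onSupp f s).card :=
      Finset.card_le_card fun X hX => by
        simp only [Finset.mem_filter, Finset.mem_univ, true_and] at hX
        exact mem_onSupp.mpr ⟨hX.1, hX.2 ▸ ha⟩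
    set k := (Finset.univ.filter fun X => X ∈ s ∧ f X = a).card
    obtain ⟨i, hi⟩ : ∃ i, k = i + 3 := ⟨k - 3, by omega⟩
    obtain ⟨j, hj⟩ : ∃ j, order P L = i + 4 + j := ⟨order P L - i - 4, by omega⟩
    rw [hi, hj, show i + 4 + j + 1 - (i + 3) = j + 2 by omega,
      show i + 3 - 1 = i + 2 by omega] at h4
    nlinarith
  have hqp : order P L = p := by
    have h1 : order P L + 1 ≤ 2 * p := by
      rw [← card_line (P := P) s]
      refine (Finset.card_le_mul_card_image (f := f) _ 2 fun a _ => ?_).trans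
        (Nat.mul_le_mul_left 2 ?_)
      · rw [Finset.filter_filter]; exact hle2 a
      · exact (Finset.card_le_univ _).trans (ZMod.card p).le
    have hp := (Fact.out : p.Prime).two_le
    rcases h with - | - | h
    · simp at hq; omega
    · simpa using hq
    · have : p * p ≤ p ^ (h + 2) := by
        rw [pow_add, sq]; exact Nat.le_mul_of_pos_left _ (by positivity)
      nlinarith
  have hTpos : 1 < T.card := by omega
  have hval : ∀ m : L, A ∈ m → m ≠ s → ∑ X ∈ T.filter fun X => X ∈ m, f X = κ - f A :=
    fun m hm hms => sum_offSupp_line hA.1 hm hms hκ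
  have hT_ne : ∀ X ∈ T, A ≠ X := fun X hX h => hTs X hX (h ▸ hA.1)
  have hTval : ∀ X ∈ T, f X = κ - f A := by
    intro X hX
    obtain ⟨m, hAm, hXm⟩ := exists_line (L := L) A X (hT_ne X hX)
    have hms : m ≠ s := fun h => hTs X hX (h ▸ hXm)
    have h1 : X ∈ T.filter fun X => X ∈ m := Finset.mem_filter.mpr ⟨hX, hXm⟩
    rw [← hval m hAm hms, Finset.eq_singleton_iff_unique_mem.mpr ⟨h1, fun Y hY =>
      Finset.card_le_one.mp (hk m hAm hms) Y hY X h1⟩, Finset.sum_singleton]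
  have hsum : ∀ D ∈ s, f D = 0 → ∀ m : L, D ∈ m → m ≠ s →
      ((T.filter fun X => X ∈ m).card : ZMod p) * (κ - f A) = κ := by
    intro D hD hD0 m hDm hms
    have h1 := sum_offSupp_line hD hDm hms hκ
    rw [Finset.sum_congr rfl fun X hX => hTval X (Finset.mem_filter.mp hX).1, hD0, sub_zero,
      Finset.sum_const, nsmul_eq_mul] at h1
    exact h1
  obtain ⟨X, hX, Y, hY, hXY⟩ := Finset.one_lt_card.mp hTpos
  have hv : κ - f A ≠ 0 := hTval X hX ▸ (mem_offSupp.mp hX).2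
  by_cases hκ0 : κ = 0
  · have hall : ∀ D ∈ s, f D = 0 → ∃ m : L, D ∈ m ∧ X ∈ m ∧ Y ∈ m := by
      intro D hD hD0
      obtain ⟨m, hDm, hXm⟩ := exists_line (L := L) D X fun h => hTs X hX (h ▸ hD)
      have hms : m ≠ s := fun h => hTs X hX (h ▸ hXm)
      have h1 := hsum D hD hD0 m hDm hms
      rw [hκ0] at h1 hv
      have h2 := (ZMod.natCast_eq_zero_iff _ _).mp ((mul_eq_zero.mp h1).resolve_right hv)
      have h3 := Nat.le_of_dvd (Finset.card_pos.mpr ⟨X, Finset.mem_filter.mpr ⟨hX, hXm⟩⟩) h2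
      have h4 : T.filter (fun X => X ∈ m) = T :=
        Finset.eq_of_subset_of_card_le (Finset.filter_subset _ _)
          ((hTle.trans hqp.le).trans h3)
      exact ⟨m, hDm, hXm, (Finset.mem_filter.mp (h4.symm ▸ hY : Y ∈ T.filter _)).2⟩
    obtain ⟨m, hBm, hXm, hYm⟩ := hall B hB hB0
    obtain ⟨m', hCm, hXm', hYm'⟩ := hall C hC hC0
    obtain rfl := eq_line_of_mem hXY hXm hYm hXm' hYm'
    exact hTs X hX (eq_line_of_mem hBC hBm hCm hB hC ▸ hXm)
  · obtain ⟨m, hm, hle⟩ : ∃ m ∈ Finset.univ.filter fun m : L => B ∈ m ∧ m ≠ s,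
        (T.filter fun X => X ∈ m).card ≤ 1 := by
      refine Finset.exists_le_of_sum_le (Finset.card_pos.mp (by rw [card_other_lines hB]; omega)) ?_
      rw [sum_card_other_lines hB hTs, ← Finset.card_eq_sum_ones, card_other_lines hB]
      exact hTle
    simp only [Finset.mem_filter, Finset.mem_univ, true_and] at hm
    have h1 := hsum B hB hB0 m hm.1 hm.2
    have h2 : (T.filter fun X => X ∈ m).card = 1 := by
      rcases Nat.le_one_iff_eq_zero_or_eq_one.mp hle with h | h
      · rw [h, Nat.cast_zero, zero_mul] at h1
        exact absurd h1.symm hκ0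
      · exact h
    rw [h2, Nat.cast_one, one_mul, sub_eq_self] at h1
    exact hA.2 h1

/-- A `(q-1)`-secant forces many points in the support, if no line has an intermediate number of
points in the support. -/
theorem le_card_offSupp {h : ℕ} (hq : order P L = p ^ h) (hq8 : 8 ≤ order P L)
    (hκ : ∀ l : L, ∑ X : P with X ∈ l, f X = κ)
    (hmul : ∀ a, (∃ X ∈ s, f X = a) →
      (order P L + 1 - (Finset.univ.filter fun X => X ∈ s ∧ f X = a).card) *
        ((Finset.univ.filter fun X => X ∈ s ∧ f X = a).card - 1) ≤ (offSupp f s).card)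
    (hdich : ∀ m : L, (onSupp f m).card ≤ 2 ∨ order P L ≤ (onSupp f m).card + 3)
    (hs : (onSupp f s).card + 1 = order P L) :
    6 * order P L ≤ (offSupp f s).card + 41 := by
  have hex : ∀ A ∈ onSupp f s, ∃ m : L, A ∈ m ∧ m ≠ s ∧ 2 < (onSupp f m).card := fun A hA =>
    exists_long_line hq (by omega) hκ hmul hs hA
  have : Nonempty L := ⟨s⟩
  choose! m hm using hex
  have hinj : Set.InjOn m (onSupp f s) := fun A hA B hB h =>
    eq_point_of_mem (hm A hA).2.1 (hm A hA).1 (h ▸ (hm B hB).1)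
      (mem_onSupp.mp hA).1 (mem_onSupp.mp hB).1
  have hcard : 7 ≤ (insert s ((onSupp f s).image m)).card := by
    rw [Finset.card_insert_of_notMem, Finset.card_image_of_injOn hinj]
    · omega
    · intro h
      obtain ⟨A, hA, h⟩ := Finset.mem_image.mp h
      exact (hm A hA).2.1 h
  obtain ⟨𝓜, h𝓜, h7⟩ := Finset.exists_subset_card_eq hcard
  have h1 := card_mul_le_card_add_choose (f := f) (r := order P L - 3) 𝓜 fun l hl => by
    rcases Finset.mem_insert.mp (h𝓜 hl) with rfl | h
    · omega
    · obtain ⟨A, hA, rfl⟩ := Finset.mem_image.mp h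
      have := hdich (m A)
      have := (hm A hA).2.2
      omega
  have h2 : (𝓜.biUnion fun m => onSupp f m).card ≤ (onSupp f s ∪ offSupp f s).card :=
    Finset.card_le_card fun X hX => by
      obtain ⟨l, -, hX⟩ := Finset.mem_biUnion.mp hX
      simp only [Finset.mem_union, mem_onSupp, mem_offSupp]
      have := (mem_onSupp.mp hX).2
      tauto
  have h3 := Finset.card_union_le (onSupp f s) (offSupp f s)
  rw [h7, show Nat.choose 7 2 = 21 from rfl] at h1
  omega

theorem two_le_card_value_of_order_seven {t : P} (hq : order P L = 7)
    (hκ : ∀ l : L, ∑ X : P with X ∈ l, f X = κ) (h3 : ∀ m : L, (onSupp f m).card ≠ 3)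
    (hs : (onSupp f s).card = 6) (hT : (offSupp f s).card ≤ 12) (ht : t ∈ offSupp f s) :
    f t ≠ κ ∧ 2 ≤ ((onSupp f s).filter fun A => κ - f A = f t).card := by
  have hts := (mem_offSupp.mp ht).1
  have hex : ∀ A ∈ s, ∃ m : L, A ∈ m ∧ t ∈ m := fun A hA =>
    exists_line A t fun h => hts (h ▸ hA)
  have : Nonempty L := ⟨s⟩
  choose! ℓ hℓ using hex
  have hsum := sum_card_joining_lines hts hℓ (Finset.notMem_erase t (offSupp f s))
  set e : P → ℕ := fun A => (((offSupp f s).erase t).filter fun X => X ∈ ℓ A).card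
  have hℓs : ∀ A ∈ s, ℓ A ≠ s := fun A hA h => hts (h ▸ (hℓ A hA).2)
  have he : ∀ A ∈ s, ((offSupp f s).filter fun X => X ∈ ℓ A).card = e A + 1 := fun A hA => by
    rw [← Finset.card_erase_add_one (Finset.mem_filter.mpr ⟨ht, (hℓ A hA).2⟩),
      ← Finset.filter_erase]
  have he0 : ∀ A ∈ s, e A = 0 → κ - f A = f t := fun A hA h => by
    have h1 := he A hA
    rw [h, zero_add] at h1
    obtain ⟨X, hX⟩ := Finset.card_eq_one.mp h1
    have h2 := sum_offSupp_line hA (hℓ A hA).1 (hℓs A hA) hκ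
    have h4 : t ∈ (offSupp f s).filter fun X => X ∈ ℓ A :=
      Finset.mem_filter.mpr ⟨ht, (hℓ A hA).2⟩
    rw [hX] at h2 h4
    rw [← h2, Finset.sum_singleton, Finset.mem_singleton.mp h4]
  have he2 : ∀ A ∈ onSupp f s, κ - f A ≠ f t → 2 ≤ e A := fun A hA hne => by
    rw [mem_onSupp] at hA
    have h1 := h3 (ℓ A)
    rw [card_onSupp_eq hA.1 (hℓ A hA.1).1 (hℓs A hA.1) hA.2, he A hA.1] at h1
    have h2 : e A ≠ 0 := fun h => hne (he0 A hA.1 h)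
    omega
  have hsplit := Finset.sum_filter_add_sum_filter_not (Finset.univ.filter fun A => A ∈ s)
    (fun A => f A = 0) e
  rw [hsum, Finset.card_erase_of_mem ht, Finset.filter_filter, Finset.filter_filter] at hsplit
  have hon : (Finset.univ.filter fun A => A ∈ s ∧ ¬ f A = 0) = onSupp f s := by
    ext; simp [mem_onSupp]
  rw [hon] at hsplit
  have hge : 2 * (6 - ((onSupp f s).filter fun A => κ - f A = f t).card) ≤
      ∑ A ∈ onSupp f s, e A := by
    rw [← hs, ← Finset.card_filter_add_card_filter_not (s := onSupp f s)
      (fun A => κ - f A = f t), Nat.add_sub_cancel_left, mul_comm, ← smul_eq_mul]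
    refine (Finset.card_nsmul_le_sum _ e 2 fun A hA => ?_).trans
      (Finset.sum_le_sum_of_subset (Finset.filter_subset _ _))
    exact he2 A (Finset.mem_filter.mp hA).1 (Finset.mem_filter.mp hA).2
  obtain ⟨A, hA⟩ := Finset.card_pos.mp
    (by omega : 0 < ((onSupp f s).filter fun A => κ - f A = f t).card)
  obtain ⟨hA, hAt⟩ := Finset.mem_filter.mp hA
  have htκ : f t ≠ κ := by
    rw [← hAt, Ne, sub_eq_self]
    exact (mem_onSupp.mp hA).2
  refine ⟨htκ, ?_⟩
  have hz := card_zeros (l := s) f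
  have hge' : (Finset.univ.filter fun A => A ∈ s ∧ f A = 0).card • 1 ≤
      ∑ A : P with A ∈ s ∧ f A = 0, e A := Finset.card_nsmul_le_sum _ e 1 fun B hB => by
    simp only [Finset.mem_filter, Finset.mem_univ, true_and] at hB
    refine Nat.one_le_iff_ne_zero.mpr fun h => htκ ?_
    rw [← he0 B hB.1 h, hB.2, sub_zero]
  rw [smul_eq_mul, mul_one] at hge'
  omega

theorem five_le_card_value_of_order_seven {A : P} (hq : order P L = 7)
    (hκ : ∀ l : L, ∑ X : P with X ∈ l, f X = κ) (h3 : ∀ m : L, (onSupp f m).card ≠ 3)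
    (hT : (offSupp f s).card ≤ 12) (hA : A ∈ onSupp f s) (hAκ : κ - f A ≠ 0) :
    5 ≤ ((offSupp f s).filter fun X => f X = κ - f A).card ∧
    ∃ 𝓝 : Finset L, 𝓝.card ≤ 2 ∧ (∀ m ∈ 𝓝, A ∈ m ∧ m ≠ s) ∧
      ∀ X ∈ offSupp f s, f X ≠ κ - f A → ∃ m ∈ 𝓝, X ∈ m := by
  rw [mem_onSupp] at hA
  set T := offSupp f s with hTdef
  have hTs : ∀ X ∈ T, X ∉ s := fun X hX => (mem_offSupp.mp hX).1
  set k : L → ℕ := fun m => (T.filter fun X => X ∈ m).card with hk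
  set 𝓛 := Finset.univ.filter fun m : L => A ∈ m ∧ m ≠ s with h𝓛
  have hmem : ∀ m ∈ 𝓛, A ∈ m ∧ m ≠ s := fun m hm => (Finset.mem_filter.mp hm).2
  have hksum : ∑ m ∈ 𝓛, k m = T.card := sum_card_other_lines hA.1 hTs
  have hcard : 𝓛.card = 7 := (card_other_lines hA.1).trans hq
  have hk0 : ∀ m ∈ 𝓛, k m ≠ 0 := fun m hm h => by
    have h1 := sum_offSupp_line hA.1 (hmem m hm).1 (hmem m hm).2 hκ
    rw [Finset.card_eq_zero.mp h, Finset.sum_empty] at h1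
    exact hAκ h1.symm
  have hk1 : ∀ m ∈ 𝓛, k m = 1 → ∀ X ∈ T, X ∈ m → f X = κ - f A := fun m hm h X hX hXm => by
    have h1 := sum_offSupp_line hA.1 (hmem m hm).1 (hmem m hm).2 hκ
    obtain ⟨Y, hY⟩ := Finset.card_eq_one.mp h
    have h2 : X ∈ T.filter fun X => X ∈ m := Finset.mem_filter.mpr ⟨hX, hXm⟩
    rw [hY] at h1 h2
    rw [← h1, Finset.sum_singleton, Finset.mem_singleton.mp h2]
  have hk3 : ∀ m ∈ 𝓛, k m ≠ 1 → 3 ≤ k m := fun m hm h => by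
    have h1 := h3 m
    rw [card_onSupp_eq hA.1 (hmem m hm).1 (hmem m hm).2 hA.2] at h1
    have h2 := hk0 m hm
    have h4 : k m = ((offSupp f s).filter fun X => X ∈ m).card := rfl
    omega
  have hsplit := Finset.sum_filter_add_sum_filter_not 𝓛 (fun m => k m = 1) k
  have hcsplit := Finset.card_filter_add_card_filter_not (s := 𝓛) (fun m => k m = 1)
  have hge1 : (𝓛.filter fun m => k m = 1).card • 1 ≤ ∑ m ∈ 𝓛 with k m = 1, k m :=
    Finset.card_nsmul_le_sum _ _ _ fun m hm => (Finset.mem_filter.mp hm).2.ge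
  have hge3 : (𝓛.filter fun m => ¬ k m = 1).card • 3 ≤ ∑ m ∈ 𝓛 with ¬ k m = 1, k m :=
    Finset.card_nsmul_le_sum _ _ _ fun m hm =>
      hk3 m (Finset.mem_filter.mp hm).1 (Finset.mem_filter.mp hm).2
  simp only [smul_eq_mul] at hge1 hge3
  refine ⟨?_, 𝓛.filter fun m => ¬ k m = 1, by omega,
    fun m hm => hmem m (Finset.mem_filter.mp hm).1, fun X hX hne => ?_⟩
  · have h1 : (𝓛.filter fun m => k m = 1).card ≤
        ∑ m ∈ 𝓛, ((T.filter fun X => f X = κ - f A).filter fun X => X ∈ m).card := by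
      rw [Finset.card_eq_sum_ones]
      refine (Finset.sum_le_sum fun m hm => ?_).trans
        (Finset.sum_le_sum_of_subset (Finset.filter_subset _ _))
      obtain ⟨hm, hm1⟩ := Finset.mem_filter.mp hm
      obtain ⟨X, hX⟩ := Finset.card_pos.mp (Nat.pos_of_ne_zero (hk0 m hm))
      obtain ⟨hXT, hXm⟩ := Finset.mem_filter.mp hX
      exact Finset.card_pos.mpr ⟨X, Finset.mem_filter.mpr
        ⟨Finset.mem_filter.mpr ⟨hXT, hk1 m hm hm1 X hXT hXm⟩, hXm⟩⟩
    rw [sum_card_other_lines hA.1 fun X hX => hTs X (Finset.mem_filter.mp hX).1] at h1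
    omega
  · obtain ⟨m, hAm, hXm⟩ := exists_line (L := L) A X fun h => hTs X hX (h ▸ hA.1)
    have hm : m ∈ 𝓛 := Finset.mem_filter.mpr
      ⟨Finset.mem_univ _, hAm, fun h => hTs X hX (h ▸ hXm)⟩
    exact ⟨m, Finset.mem_filter.mpr ⟨hm, fun h => hne (hk1 m hm h X hX hXm)⟩, hXm⟩

theorem value_eq_of_order_seven (hq : order P L = 7)
    (hκ : ∀ l : L, ∑ X : P with X ∈ l, f X = κ) (h3 : ∀ m : L, (onSupp f m).card ≠ 3)
    (hs : (onSupp f s).card = 6) (hT : (offSupp f s).card ≤ 12) {t t' : P}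
    (ht : t ∈ offSupp f s) (ht' : t' ∈ offSupp f s) : f t = f t' := by
  by_contra hne
  obtain ⟨A, hA, B, hB, hAB⟩ := Finset.one_lt_card.mp
    (two_le_card_value_of_order_seven hq hκ h3 hs hT ht).2
  obtain ⟨C, hC⟩ := Finset.card_pos.mp (lt_of_lt_of_le two_pos
    (two_le_card_value_of_order_seven hq hκ h3 hs hT ht').2)
  obtain ⟨hA, hAt⟩ := Finset.mem_filter.mp hA
  obtain ⟨hB, hBt⟩ := Finset.mem_filter.mp hB
  obtain ⟨hC, hCt⟩ := Finset.mem_filter.mp hC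
  have hft := (mem_offSupp.mp ht).2
  have hft' := (mem_offSupp.mp ht').2
  obtain ⟨-, 𝓐, h𝓐, hmem𝓐, hcov𝓐⟩ :=
    five_le_card_value_of_order_seven hq hκ h3 hT hA (hAt ▸ hft)
  obtain ⟨-, 𝓑, h𝓑, hmem𝓑, hcov𝓑⟩ :=
    five_le_card_value_of_order_seven hq hκ h3 hT hB (hBt ▸ hft)
  have h5 := (five_le_card_value_of_order_seven hq hκ h3 hT hC (hCt ▸ hft')).1
  rw [hCt] at h5
  have hsub : ((offSupp f s).filter fun X => f X = f t') ⊆ (𝓐 ×ˢ 𝓑).biUnion fun z =>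
      Finset.univ.filter fun X => X ∈ z.1 ∧ X ∈ z.2 := by
    intro X hX
    obtain ⟨hX, hXt⟩ := Finset.mem_filter.mp hX
    obtain ⟨m, hm, hXm⟩ := hcov𝓐 X hX (by rw [hAt, hXt]; exact Ne.symm hne)
    obtain ⟨m', hm', hXm'⟩ := hcov𝓑 X hX (by rw [hBt, hXt]; exact Ne.symm hne)
    exact Finset.mem_biUnion.mpr ⟨(m, m'), Finset.mem_product.mpr ⟨hm, hm'⟩, by simp [hXm, hXm']⟩
  have h1 := (Finset.card_le_card hsub).trans (Finset.card_biUnion_le_card_mul _ _ 1 fun z hz => by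
    obtain ⟨hz1, hz2⟩ := Finset.mem_product.mp hz
    have hzne : z.1 ≠ z.2 := fun h => (hmem𝓐 _ hz1).2 (eq_line_of_mem hAB (hmem𝓐 _ hz1).1
      (h ▸ (hmem𝓑 _ hz2).1) (mem_onSupp.mp hA).1 (mem_onSupp.mp hB).1)
    refine Finset.card_le_one.mpr fun X hX Y hY => ?_
    simp only [Finset.mem_filter, Finset.mem_univ, true_and] at hX hY
    exact eq_point_of_mem hzne hX.1 hY.1 hX.2 hY.2)
  rw [Finset.card_product, mul_one] at h1
  have := Nat.mul_le_mul h𝓐 h𝓑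
  omega

theorem le_card_offSupp_of_order_seven (hq : order P L = 7) (hp : p = 7)
    (hκ : ∀ l : L, ∑ X : P with X ∈ l, f X = κ) (h3 : ∀ m : L, (onSupp f m).card ≠ 3)
    (hs : (onSupp f s).card = 6) : 13 ≤ (offSupp f s).card := by
  by_contra! hT
  replace hT : (offSupp f s).card ≤ 12 := by omega
  have hTs : ∀ X ∈ offSupp f s, X ∉ s := fun X hX => (mem_offSupp.mp hX).1
  by_cases hκ0 : κ = 0
  · obtain ⟨A, hA⟩ := Finset.card_pos.mp (by omega : 0 < (onSupp f s).card)
    have hex : ∀ B ∈ onSupp f s, ∃ X ∈ offSupp f s, f X = -f B := fun B hB => by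
      have h5 := (five_le_card_value_of_order_seven hq hκ h3 hT hB
        (by simpa [hκ0] using (mem_onSupp.mp hB).2)).1
      obtain ⟨X, hX⟩ := Finset.card_pos.mp (by omega :
        0 < ((offSupp f s).filter fun X => f X = κ - f B).card)
      exact ⟨X, by simpa [hκ0] using hX⟩
    have hall : ∀ B ∈ onSupp f s, f B = f A := fun B hB => by
      obtain ⟨X, hX, hXA⟩ := hex A hA
      obtain ⟨Y, hY, hYB⟩ := hex B hB
      have := value_eq_of_order_seven hq hκ h3 hs hT hX hY
      rw [hXA, hYB] at this
      exact (neg_injective this).symm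
    have h1 := sum_onSupp f s
    rw [hκ s, hκ0, Finset.sum_congr rfl hall, Finset.sum_const, hs, nsmul_eq_mul] at h1
    refine (mem_onSupp.mp hA).2 ((mul_eq_zero.mp h1).resolve_left fun h => ?_)
    rw [ZMod.natCast_eq_zero_iff, hp] at h
    omega
  · obtain ⟨B, C, -, hB, hB0, -, -⟩ := exists_two_zeros (f := f) (s := s) (by omega)
    have h1 := Finset.card_nsmul_le_sum (Finset.univ.filter fun m : L => B ∈ m ∧ m ≠ s)
      (fun m => ((offSupp f s).filter fun X => X ∈ m).card) 2 fun m hm => by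
        obtain ⟨hBm, hms⟩ := (Finset.mem_filter.mp hm).2
        have h2 := sum_offSupp_line hB hBm hms hκ
        rw [hB0, sub_zero] at h2
        by_contra! hlt
        rcases Nat.le_one_iff_eq_zero_or_eq_one.mp (Nat.le_of_lt_succ hlt) with h0 | h0
        · rw [Finset.card_eq_zero.mp h0, Finset.sum_empty] at h2
          exact hκ0 h2.symm
        · obtain ⟨X, hX⟩ := Finset.card_eq_one.mp h0
          rw [hX, Finset.sum_singleton] at h2
          have hXT : X ∈ offSupp f s :=
            (Finset.mem_filter.mp (hX ▸ Finset.mem_singleton_self X)).1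
          exact (two_le_card_value_of_order_seven hq hκ h3 hs hT hXT).1 h2
    rw [sum_card_other_lines hB hTs, card_other_lines hB, hq, smul_eq_mul] at h1
    omega

end PlaneTheorems

section Reduction
open Configuration ProjectivePlane Projectivization

variable {p n : ℕ}

theorem ptIn_mk (W : Submodule F (Fin (n + 1) → F)) (v : Fin (n + 1) → F) (hv : v ≠ 0) :
    ptIn (Projectivization.mk F v hv) W ↔ v ∈ W := by
  rw [ptIn, Projectivization.submodule_mk, Submodule.span_singleton_le_iff_mem]

theorem exists_vcode_of_mem_code {c : Pt F n → ZMod p} (hc : c ∈ code F p n) :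
    ∃ g ∈ vcode F p (Fin (n + 1) → F), ∀ v hv, c (Projectivization.mk F v hv) = g v := by
  induction hc using Submodule.span_induction with
  | mem c hc =>
    obtain ⟨W, hW, rfl⟩ := hc
    obtain ⟨φ, hφ, hle⟩ := Submodule.exists_le_ker_of_lt_top W (lt_top_iff_ne_top.mpr fun h => by
      rw [h, finrank_top, Module.finrank_fin_fun] at hW
      omega)
    have hker := Module.Dual.finrank_ker_add_one_of_ne_zero hφ
    rw [Module.finrank_fin_fun] at hker
    have hWφ : W = LinearMap.ker φ := Submodule.eq_of_le_of_finrank_eq hle (by omega)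
    refine ⟨_, Submodule.subset_span ⟨φ, rfl⟩, fun v hv => ?_⟩
    simp only [incVec, ptIn_mk, hWφ, LinearMap.mem_ker]
  | zero => exact ⟨0, Submodule.zero_mem _, fun v hv => rfl⟩
  | add c c' _ _ h h' =>
    obtain ⟨g, hg, h⟩ := h
    obtain ⟨g', hg', h'⟩ := h'
    exact ⟨g + g', Submodule.add_mem _ hg hg', fun v hv => by simp [h, h']⟩
  | smul a c _ h =>
    obtain ⟨g, hg, h⟩ := h
    exact ⟨a • g, Submodule.smul_mem _ a hg, fun v hv => by simp [h]⟩

/-- The subspace spanned by the points of a line of the plane. -/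
def lineSpace (m : Pl F) : Submodule F (Fin 3 → F) := LinearMap.ker (dotProductBilin F F m.rep)

theorem mem_lineSpace (m : Pl F) (v : Fin 3 → F) (hv : v ≠ 0) :
    v ∈ lineSpace m ↔ Projectivization.mk F v hv ∈ m := by
  rw [mk_mem_iff, dotProduct_comm]
  exact LinearMap.mem_ker

theorem finrank_lineSpace (m : Pl F) : Module.finrank F (lineSpace m) = 2 := by
  have h : dotProductBilin F F m.rep ≠ (0 : Module.Dual F (Fin 3 → F)) := fun h =>
    m.rep_nonzero (dotProduct_eq_zero_iff.mp fun v => LinearMap.congr_fun h v)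
  have := Module.Dual.finrank_ker_add_one_of_ne_zero h
  rw [Module.finrank_fin_fun] at this
  exact Nat.succ_injective this

theorem secant_map [Fintype F] {c : Pt F n → ZMod p} {g : (Fin (n + 1) → F) → ZMod p}
    (hcg : ∀ v hv, c (Projectivization.mk F v hv) = g v)
    {Λ : (Fin 3 → F) →ₗ[F] (Fin (n + 1) → F)} (hΛ : Function.Injective Λ) (m : Pl F) :
    secant c ((lineSpace m).map Λ) (onSupp (fun X : Pl F => g (Λ X.rep)) m).card := by
  refine ⟨?_, ?_⟩
  · rw [IsLine, ← (Submodule.equivMapOfInjective Λ hΛ _).finrank_eq, finrank_lineSpace]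
  · have hc : ∀ X : Pl F, c (X.map Λ hΛ) = g (Λ X.rep) := fun X => by
      conv_lhs => rw [← X.mk_rep, Projectivization.map_mk]
      rw [hcg]
    have hmem : ∀ X : Pl F, ptIn (X.map Λ hΛ) ((lineSpace m).map Λ) ↔ X ∈ m := fun X => by
      conv_lhs => rw [← X.mk_rep, Projectivization.map_mk]
      rw [ptIn_mk, ← Submodule.mem_comap, Submodule.comap_map_eq_of_injective hΛ,
        mem_lineSpace m _ X.rep_nonzero, X.mk_rep]
    have himg : ptsIn ((lineSpace m).map Λ) ∩ supp c =
        Projectivization.map Λ hΛ '' (onSupp (fun X : Pl F => g (Λ X.rep)) m : Set (Pl F)) := by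
      ext Q
      constructor
      · rintro ⟨hQ, hQc⟩
        have hQ' : Q.rep ∈ (lineSpace m).map Λ := by
          rw [← ptIn_mk _ _ Q.rep_nonzero, Q.mk_rep]
          exact hQ
        obtain ⟨v, hv, hvQ⟩ := hQ'
        have hv0 : v ≠ 0 := by
          rintro rfl
          exact Q.rep_nonzero (by rw [← hvQ, map_zero])
        have hQeq : (Projectivization.mk F v hv0).map Λ hΛ = Q := by
          rw [Projectivization.map_mk]
          conv_rhs => rw [← Q.mk_rep]
          simp only [hvQ]
        refine ⟨_, ?_, hQeq⟩
        rw [Finset.mem_coe, mem_onSupp, ← hc, hQeq, ← mem_lineSpace]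
        exact ⟨hv, hQc⟩
      · rintro ⟨X, hX, rfl⟩
        rw [Finset.mem_coe, mem_onSupp, ← hc] at hX
        exact ⟨(hmem X).mpr hX.1, hX.2⟩
    rw [himg, Set.ncard_image_of_injective _ (Projectivization.map_injective Λ hΛ),
      Set.ncard_coe_finset]

/-- The line `X₂ = 0` of the plane. -/
def baseLine (F : Type) [Field F] : Pl F := Projectivization.mk F ![0, 0, 1] (by simp)

theorem mem_baseLine (X : Pl F) : X ∈ baseLine F ↔ X.rep 2 = 0 := by
  conv_lhs => rw [← X.mk_rep]
  refine (Iff.rfl : _ ↔ X.rep ⬝ᵥ ![0, 0, 1] = 0).trans ?_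
  simp [dotProduct, Fin.sum_univ_three]

/-- The planes through a line `l` are parametrized by the points of the quotient by `l`. -/
theorem exists_plane {V : Type} [AddCommGroup V] [Module F V] (l : Submodule F V)
    (hl : Module.finrank F l = 2) (Y : Projectivization F (V ⧸ l)) :
    ∃ Λ : (Fin 3 → F) →ₗ[F] V, Function.Injective Λ ∧ (∀ v, l.mkQ (Λ v) = v 2 • Y.rep) ∧
      (lineSpace (baseLine F)).map Λ = l := by
  have : Module.Finite F l := Module.finite_of_finrank_pos (by omega)
  let ε : (Fin 2 → F) ≃ₗ[F] l := LinearEquiv.ofFinrankEq _ _ (by simp [hl])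
  obtain ⟨e, he⟩ := l.mkQ_surjective Y.rep
  let Λ : (Fin 3 → F) →ₗ[F] V :=
    l.subtype ∘ₗ ε.toLinearMap ∘ₗ LinearMap.funLeft F F ![0, 1] +
      (LinearMap.proj 2 : (Fin 3 → F) →ₗ[F] F).smulRight e
  have hmkQ : ∀ v, l.mkQ (Λ v) = v 2 • Y.rep := fun v => by
    rw [← he]
    simp [Λ]
  have hinj : Function.Injective Λ := by
    rw [injective_iff_map_eq_zero]
    intro v hv
    have h2 : v 2 = 0 := by
      have := hmkQ v
      rw [hv, map_zero, eq_comm, smul_eq_zero] at this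
      exact this.resolve_right Y.rep_nonzero
    have h01 : LinearMap.funLeft F F (![0, 1] : Fin 2 → Fin 3) v = (0 : Fin 2 → F) := by
      simpa [Λ, h2] using hv
    have h0 := congrFun h01 0
    have h1 := congrFun h01 1
    ext i
    fin_cases i
    · exact h0
    · exact h1
    · exact h2
  refine ⟨Λ, hinj, hmkQ, Submodule.eq_of_le_of_finrank_eq ?_ ?_⟩
  · rintro _ ⟨v, hv, rfl⟩
    rw [← l.ker_mkQ, LinearMap.mem_ker, hmkQ]
    by_cases hv0 : v = 0
    · simp [hv0]
    · have := (mem_lineSpace _ v hv0).mp hv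
      have h2 : v ⬝ᵥ ![0, 0, 1] = 0 := this
      simp [dotProduct, Fin.sum_univ_three] at h2
      rw [h2, zero_smul]
  · rw [← (Submodule.equivMapOfInjective Λ hinj _).finrank_eq, finrank_lineSpace, hl]

end Reduction

section Counting
open Configuration ProjectivePlane Projectivization

variable {p n : ℕ}

theorem card_quotient_line [Fintype F] {l : Submodule F (Fin (n + 1) → F)} (hl : IsLine l) :
    Nat.card (Projectivization F ((Fin (n + 1) → F) ⧸ l)) =
      ∑ i ∈ Finset.range (n - 1), Fintype.card F ^ i := by
  rw [← Nat.card_eq_fintype_card]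
  refine Projectivization.card_of_finrank F _ ?_
  have := l.finrank_quotient_add_finrank
  rw [Module.finrank_fin_fun, show Module.finrank F l = 2 from hl] at this
  omega

/-- Counting the support of a word over the planes through a line. -/
theorem card_mul_add_le_wt [Fintype F] {c : Pt F n → ZMod p} {g : (Fin (n + 1) → F) → ZMod p}
    (hcg : ∀ v hv, c (Projectivization.mk F v hv) = g v)
    {l : Submodule F (Fin (n + 1) → F)} {α : ℕ} (hl : secant c l α) {m : ℕ}
    (hm : ∀ Λ : (Fin 3 → F) →ₗ[F] (Fin (n + 1) → F), Function.Injective Λ →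
      (lineSpace (baseLine F)).map Λ = l →
        m ≤ (offSupp (fun X : Pl F => g (Λ X.rep)) (baseLine F)).card) :
    (∑ i ∈ Finset.range (n - 1), Fintype.card F ^ i) * m + α ≤ wt c := by
  choose Λ hinj hmkQ hmap using exists_plane l hl.1
  have : Fintype (Projectivization F ((Fin (n + 1) → F) ⧸ l)) := Fintype.ofFinite _
  let T : Projectivization F ((Fin (n + 1) → F) ⧸ l) → Finset (Pt F n) := fun Y =>
    (offSupp (fun X : Pl F => g (Λ Y X.rep)) (baseLine F)).image
      (Projectivization.map (Λ Y) (hinj Y))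
  have hmk : ∀ Y (X : Pl F), X.map (Λ Y) (hinj Y) = Projectivization.mk F (Λ Y X.rep)
      (fun h => X.rep_nonzero (hinj Y (h.trans (map_zero _).symm))) := fun Y X => by
    conv_lhs => rw [← X.mk_rep, Projectivization.map_mk]
  have hT : ∀ Y, m ≤ (T Y).card := fun Y => by
    rw [Finset.card_image_of_injective _ (Projectivization.map_injective _ (hinj Y))]
    exact hm _ (hinj Y) (hmap Y)
  have hdisj : Set.PairwiseDisjoint
      ((Finset.univ : Finset (Projectivization F ((Fin (n + 1) → F) ⧸ l))) : Set _) T := by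
    intro Y _ Y' _ hne
    rw [Function.onFun, Finset.disjoint_left]
    intro Q hQ hQ'
    obtain ⟨X, hX, rfl⟩ := Finset.mem_image.mp hQ
    obtain ⟨X', -, hXX'⟩ := Finset.mem_image.mp hQ'
    rw [mem_offSupp, mem_baseLine] at hX
    rw [hmk, hmk, eq_comm, mk_eq_mk_iff'] at hXX'
    obtain ⟨a, ha⟩ := hXX'
    have h := congrArg l.mkQ ha
    rw [map_smul, hmkQ, hmkQ, smul_smul] at h
    refine hne ?_
    rw [← Y.mk_rep, ← Y'.mk_rep, mk_eq_mk_iff']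
    exact ⟨(X.rep 2)⁻¹ * (a * X'.rep 2), by
      rw [mul_smul, h, smul_smul, inv_mul_cancel₀ hX.1, one_smul]⟩
  have hsub : (Finset.univ.biUnion T : Set (Pt F n)) ⊆ supp c \ ptsIn l := by
    intro Q hQ
    obtain ⟨Y, -, hQ⟩ := Finset.mem_biUnion.mp hQ
    obtain ⟨X, hX, rfl⟩ := Finset.mem_image.mp hQ
    rw [mem_offSupp, mem_baseLine] at hX
    refine ⟨?_, fun hQl => hX.1 ?_⟩
    · rw [supp, Set.mem_ofPred_eq, hmk, hcg]
      exact hX.2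
    · rw [ptsIn, Set.mem_ofPred_eq, hmk, ptIn_mk, ← l.ker_mkQ, LinearMap.mem_ker, hmkQ,
        smul_eq_zero] at hQl
      exact hQl.resolve_right Y.rep_nonzero
  have hcard := Set.ncard_le_ncard hsub (Set.toFinite _)
  rw [Set.ncard_coe_finset, Finset.card_biUnion hdisj] at hcard
  have hsum := Finset.card_nsmul_le_sum Finset.univ _ m fun Y _ => hT Y
  rw [Finset.card_univ, smul_eq_mul, ← Nat.card_eq_fintype_card, card_quotient_line hl.1] at hsum
  have := Set.ncard_inter_add_ncard_sdiff_eq_ncard (supp c) (ptsIn l) (Set.toFinite _)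
  rw [Set.inter_comm, hl.2] at this
  rw [wt]
  omega

end Counting

section SecantBounds
open Configuration ProjectivePlane Projectivization

variable {p n : ℕ}

theorem card_onSupp_baseLine [Fintype F] {c : Pt F n → ZMod p} {g : (Fin (n + 1) → F) → ZMod p}
    (hcg : ∀ v hv, c (Projectivization.mk F v hv) = g v) {l : Submodule F (Fin (n + 1) → F)}
    {α : ℕ} (hl : secant c l α) {Λ : (Fin 3 → F) →ₗ[F] (Fin (n + 1) → F)}
    (hΛ : Function.Injective Λ) (hmap : (lineSpace (baseLine F)).map Λ = l) :
    (onSupp (fun X : Pl F => g (Λ X.rep)) (baseLine F)).card = α := by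
  have h := secant_map hcg hΛ (baseLine F)
  rw [hmap] at h
  exact h.2.symm.trans hl.2

theorem card_mul_le_card_offSupp [Fintype F] [CharP F p] [Fact p.Prime]
    {g : (Fin 3 → F) → ZMod p} (hg : g ∈ vcode F p (Fin 3 → F)) (l : Pl F) (a : ZMod p)
    (hpos : ∃ X ∈ l, g X.rep = a) :
    (Fintype.card F + 1 - (Finset.univ.filter fun X : Pl F => X ∈ l ∧ g X.rep = a).card) *
      ((Finset.univ.filter fun X : Pl F => X ∈ l ∧ g X.rep = a).card - 1) ≤
      (offSupp (fun X : Pl F => g X.rep) l).card := by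
  refine (card_value_mul_le hg l a hpos).trans_eq ?_
  rw [offSupp]
  congr!

/-- Every plane through an `α`-secant, `α ≤ q`, has at least `α (q - α)` support points off it. -/
theorem card_mul_add_le_wt_of_secant [Fintype F] [CharP F p] [Fact p.Prime] {c : Pt F n → ZMod p}
    (hc : c ∈ code F p n) {l : Submodule F (Fin (n + 1) → F)} {α : ℕ} (hl : secant c l α)
    (hα : α ≤ Fintype.card F) :
    (∑ i ∈ Finset.range (n - 1), Fintype.card F ^ i) * (α * (Fintype.card F - α)) + α ≤ wt c := by
  obtain ⟨g, hg, hcg⟩ := exists_vcode_of_mem_code hc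
  refine card_mul_add_le_wt hcg hl fun Λ hΛ hmap => ?_
  have hz := card_zeros (l := baseLine F) fun X : Pl F => g (Λ X.rep)
  rw [card_onSupp_baseLine hcg hl hΛ hmap, order_eq] at hz
  obtain ⟨A, hA⟩ := Finset.card_pos.mp (by omega : 0 < (Finset.univ.filter fun X : Pl F =>
    X ∈ baseLine F ∧ g (Λ X.rep) = 0).card)
  refine le_trans (le_of_eq ?_) (card_mul_le_card_offSupp (comp_mem_vcode Λ hg) (baseLine F) 0
    ⟨A, by simpa using hA⟩)
  simp only [Function.comp_apply]
  congr 1 <;> omega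

end SecantBounds

section WeightBound

theorem B_le {q : ℕ} (n : ℕ) (hq : 8 ≤ q) (hqex : q ∉ ({8, 9, 16, 25, 27, 49} : Set ℕ)) :
    B n q ≤ (4 * q - 16) * (q : ℝ) ^ (n - 2) ∧ B n q ≤ (6 * q - 41) * (q : ℝ) ^ (n - 2) := by
  have hpos : (0 : ℝ) ≤ (q : ℝ) ^ (n - 2) := by positivity
  simp only [Set.mem_insert_iff, Set.mem_singleton_iff, not_or] at hqex
  have h9 : (9 : ℝ) ≤ q := by exact_mod_cast (by omega : 9 ≤ q)
  unfold B
  split_ifs with h₁ h₂ h₃ h₄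
  · omega
  · have : q = 11 ∨ q = 13 ∨ q = 17 := by omega
    have h := Real.le_sqrt_of_sq_le (x := 7.5) (y := 6 * q) (by
      rcases this with rfl | rfl | rfl <;> norm_num)
    constructor <;> refine mul_le_mul_of_nonneg_right ?_ hpos <;>
      rcases this with rfl | rfl | rfl <;> norm_num at h ⊢ <;> linarith
  · have h := Real.le_sqrt_of_sq_le (x := 7) (y := 6 * q) (by norm_num; linarith)
    constructor <;> refine mul_le_mul_of_nonneg_right ?_ hpos <;>
      rcases h₃ with rfl | rfl <;> norm_num at h ⊢ <;> linarith
  · have h := Real.le_sqrt_of_sq_le (x := 2) (y := q) (by norm_num; linarith)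
    constructor <;> refine mul_le_mul_of_nonneg_right ?_ hpos <;>
      rcases h₄ with rfl | rfl | rfl <;> norm_num at h ⊢ <;> linarith
  · have h := Real.le_sqrt_of_sq_le (x := 8) (y := 8 * q) (by norm_num; linarith)
    constructor <;> refine mul_le_mul_of_nonneg_right ?_ hpos <;> linarith

theorem B_seven_le (n : ℕ) : B n 7 ≤ 14.02 * 7 ^ (n - 2) := by
  have h : (6.48 : ℝ) ≤ √(6 * 7) := Real.le_sqrt_of_sq_le (by norm_num)
  simp only [B]
  norm_num at h ⊢
  linarith

theorem pow_le_sum_pow (q : ℕ) {n : ℕ} (hn : 2 ≤ n) :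
    q ^ (n - 2) ≤ ∑ i ∈ Finset.range (n - 1), q ^ i :=
  Finset.single_le_sum (f := fun i => q ^ i) (fun _ _ => Nat.zero_le _)
    (Finset.mem_range.mpr (by omega))

end WeightBound

/-- Lemma 14 of the paper: if there is a `(q-1)`-secant to `supp c`, then
there is also a `3`-secant. -/
theorem statement5 [Fintype F] {p h q n : ℕ} [Fact p.Prime] (hh : 1 ≤ h) (hq : q = p ^ h)
    (hF : Fintype.card F = q) (hq7 : 7 ≤ q)
    (hqex : q ∉ ({8, 9, 16, 25, 27, 49} : Set ℕ)) (hn : 2 ≤ n)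
    (c : Pt F n → ZMod p) (hc : c ∈ code F p n) (hwt : (wt c : ℝ) ≤ B n q)
    (hsec : ∃ l : Submodule F (Fin (n + 1) → F), secant c l (q - 1)) :
    ∃ l : Submodule F (Fin (n + 1) → F), secant c l 3 := by
  have : CharP F p := charP_of_card_eq_prime_pow (hF.trans hq)
  obtain ⟨l, hl⟩ := hsec
  obtain ⟨g, hg, hcg⟩ := exists_vcode_of_mem_code hc
  by_contra! hno
  rcases eq_or_lt_of_le hq7 with rfl | hq8
  · have hp : p = 7 := (Nat.prime_dvd_prime_iff_eq Fact.out Nat.prime_seven).mp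
      (hq ▸ dvd_pow_self p (by omega))
    have hle := card_mul_add_le_wt hcg hl (m := 13) fun Λ hΛ hmap => by
      obtain ⟨κ, hκ⟩ := sum_line_eq (comp_mem_vcode Λ hg)
      exact le_card_offSupp_of_order_seven (order_eq.trans hF) hp hκ
        (fun m h3 => hno _ (h3 ▸ secant_map hcg hΛ m)) (card_onSupp_baseLine hcg hl hΛ hmap)
    have hgeom := geom_sum_mul_add 6 (n - 1)
    rw [show n - 1 = n - 2 + 1 by omega] at hgeom hle
    rw [hF] at hle
    have hle' := (Nat.cast_le (α := ℝ)).mpr hle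
    have hgeom' := congrArg (Nat.cast (R := ℝ)) hgeom
    have := hwt.trans (B_seven_le n)
    have hpos : (0 : ℝ) < 7 ^ (n - 2) := by positivity
    push_cast [pow_succ (_ : ℝ) (n - 2)] at hle' hgeom'
    linarith
  · obtain ⟨hB₁, hB₂⟩ := B_le n hq8 hqex
    have hpow := (Nat.cast_le (α := ℝ)).mpr (pow_le_sum_pow q hn)
    have hq8' : (8 : ℝ) ≤ q := by exact_mod_cast hq8
    push_cast at hpow
    have hdich : ∀ m α, secant c m α → α ≤ 2 ∨ q ≤ α + 3 := fun m α hm => by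
      by_contra! hα
      have h3 : α ≠ 3 := fun h3 => hno m (h3 ▸ hm)
      have hle := (Nat.cast_le (α := ℝ)).mpr
        (card_mul_add_le_wt_of_secant hc hm (by omega))
      obtain ⟨s, rfl⟩ := Nat.exists_eq_add_of_le (show 4 ≤ α by omega)
      obtain ⟨t, rfl⟩ := Nat.exists_eq_add_of_le (show 4 + s + 4 ≤ q by omega)
      rw [hF, show 4 + s + 4 + t - (4 + s) = 4 + t by omega] at hle
      push_cast at hle hpow hB₁ hwt
      have := mul_le_mul hpow (show (16 + 4 * s + 4 * t : ℝ) ≤ (4 + s) * (4 + t) by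
        nlinarith [mul_nonneg s.cast_nonneg (α := ℝ) t.cast_nonneg]) (by positivity)
        (by positivity)
      linarith [s.cast_nonneg (α := ℝ)]
    have hle := (Nat.cast_le (α := ℝ)).mpr <| card_mul_add_le_wt hcg hl (m := 6 * q - 41)
      fun Λ hΛ hmap => by
        obtain ⟨κ, hκ⟩ := sum_line_eq (comp_mem_vcode Λ hg)
        have := le_card_offSupp (h := h) (order_eq.trans (hF.trans hq))
          (by rw [order_eq, hF]; omega) hκ
          (fun a ha => by
            rw [order_eq]
            exact card_mul_le_card_offSupp (comp_mem_vcode Λ hg) (baseLine F) a ha)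
          (fun m => by
            rw [order_eq, hF]
            exact hdich _ _ (secant_map hcg hΛ m))
          (by
            rw [order_eq, hF]
            exact (congrArg (· + 1) (card_onSupp_baseLine hcg hl hΛ hmap)).trans (by omega))
        rw [order_eq, hF] at this
        exact Nat.sub_le_iff_le_add.mpr this
    rw [hF] at hle
    push_cast [Nat.cast_sub (show 41 ≤ 6 * q by omega), Nat.cast_sub (show 1 ≤ q by omega)] at hle
    have := mul_le_mul_of_nonneg_left hpow (show (0 : ℝ) ≤ 6 * q - 41 by linarith)
    linarith

end PGCode
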